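/- arXiv:1607.03551 — 7 statements merged into one kernel-verified Lean document; each statement's English description precedes it below -/
import Mathlib

section
/- Let n ≥ 1 and p ≥ 1 be integers and let I ⊆ S = ℝ[x_0,…,x_n] be a homogeneous ideal with I_1 = 0 (non-degeneracy). Suppose that the p-base-point-free property holds: for every linear subspace W ⊆ S_1 of codimension at most p in S_1 such that the forms in W have no common zero on V(I) ∖ {0}, one has S_2 ⊆ I_2 + W·S_1 (the degree-2 part of the ideal generated by I and W contains all quadrics). Then every ℓ spanning an extreme ray of the Hankel cone Σ*(I) satisfies rank(ℓ) = 1 or rank(ℓ) ≥ p + 1; i.e., the Hankel index of V(I) is at least p + 1. -/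
open MvPolynomial

noncomputable section

/-- The polynomial ring `S = ℝ[x_0, …, x_n]`. -/
abbrev PolyS (n : ℕ) := MvPolynomial (Fin (n + 1)) ℝ

/-- The space `S_2` of homogeneous quadratic forms. -/
abbrev S2 (n : ℕ) : Submodule ℝ (PolyS n) := homogeneousSubmodule (Fin (n + 1)) ℝ 2

lemma sq_mem_S2 {n : ℕ} {f : PolyS n} (hf : f.IsHomogeneous 1) : f * f ∈ S2 n := by
  rw [mem_homogeneousSubmodule]
  simpa using hf.mul hf

lemma XX_mem_S2 {n : ℕ} (i j : Fin (n + 1)) : (X i : PolyS n) * X j ∈ S2 n := by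
  rw [mem_homogeneousSubmodule]
  simpa using (isHomogeneous_X ℝ i).mul (isHomogeneous_X ℝ j)

/-- `I` is a homogeneous ideal. -/
def IsHomIdeal {n : ℕ} (I : Ideal (PolyS n)) : Prop :=
  ∀ f ∈ I, ∀ d : ℕ, homogeneousComponent d f ∈ I

/-- The Hankel cone `Σ*(I)`: linear functionals on `S_2` vanishing on `I_2` whose
associated bilinear form `B_ℓ(f,g) = ℓ(f·g)` on `S_1` is positive semidefinite. -/
def SigmaStar {n : ℕ} (I : Ideal (PolyS n)) : Set (S2 n →ₗ[ℝ] ℝ) :=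
  { l | (∀ q : S2 n, (q : PolyS n) ∈ I → l q = 0) ∧
        ∀ (f : PolyS n) (hf : f.IsHomogeneous 1), 0 ≤ l ⟨f * f, sq_mem_S2 hf⟩ }

/-- The rank of the bilinear form `B_ℓ` on `S_1`, computed as the rank of its matrix
in the basis of the variables. -/
def rankL {n : ℕ} (l : S2 n →ₗ[ℝ] ℝ) : ℕ :=
  (Matrix.of fun i j : Fin (n + 1) => l ⟨X i * X j, XX_mem_S2 i j⟩).rank

/-- `l` spans an extreme ray of the convex cone `C`. -/
def IsExtremeIn {n : ℕ} (C : Set (S2 n →ₗ[ℝ] ℝ)) (l : S2 n →ₗ[ℝ] ℝ) : Prop :=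
  l ∈ C ∧ l ≠ 0 ∧ ∀ l₁ ∈ C, ∀ l₂ ∈ C, l = l₁ + l₂ →
    (∃ c : ℝ, 0 ≤ c ∧ l₁ = c • l) ∧ ∃ c : ℝ, 0 ≤ c ∧ l₂ = c • l

/-- The complex zero set `V(I) ⊆ ℂ^{n+1}`. -/
def VC {n : ℕ} (I : Ideal (PolyS n)) : Set (Fin (n + 1) → ℂ) :=
  { z | ∀ f ∈ I, aeval z f = 0 }

/-- The `p`-base-point-free property: every linear series `W ⊆ S_1` of codimension at most
`p` in `S_1` without common zeros on `V(I) ∖ {0}` satisfies `S_2 ⊆ I_2 + W·S_1`. -/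
def pBPF {n : ℕ} (I : Ideal (PolyS n)) (p : ℕ) : Prop :=
  ∀ W : Submodule ℝ (PolyS n), W ≤ homogeneousSubmodule (Fin (n + 1)) ℝ 1 →
    n + 1 ≤ Module.finrank ℝ W + p →
    (∀ z ∈ VC I, z ≠ 0 → ∃ w ∈ W, aeval z w ≠ 0) →
    ∀ q : PolyS n, q.IsHomogeneous 2 →
      ∃ a ∈ I, a.IsHomogeneous 2 ∧ q - a ∈ Ideal.span (W : Set (PolyS n))

/-- If `B` is positive semidefinite and the kernel of `B` is contained in that of `N`, then the
quadratic form of `N` is dominated by a multiple of that of `B`. -/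
lemma exists_abs_le_mul_of_ker_le {V : Type*} [AddCommGroup V] [Module ℝ V]
    [FiniteDimensional ℝ V] (B N : LinearMap.BilinForm ℝ V) (hB : LinearMap.IsSymm B)
    (hpos : ∀ x, 0 ≤ B x x) (hN : LinearMap.IsSymm N) (hker : ∀ x, B x = 0 → N x = 0) :
    ∃ K : ℝ, 0 ≤ K ∧ ∀ x, |N x x| ≤ K * B x x := by
  obtain ⟨v, hv⟩ := LinearMap.BilinForm.exists_orthogonal_basis hB
  have hdiag : ∀ x, B x x = ∑ i, v.repr x i ^ 2 * B (v i) (v i) := by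
    intro x
    conv_lhs => rw [← v.sum_repr x]
    simp only [map_sum, LinearMap.sum_apply, map_smul, LinearMap.smul_apply, smul_eq_mul]
    refine Finset.sum_congr rfl fun i _ => ?_
    rw [Finset.sum_eq_single i]
    · ring
    · intro j _ hj
      rw [show B (v j) (v i) = 0 from hv hj]
      ring
    · simp
  have hexp : ∀ x, N x x = ∑ i, ∑ j, v.repr x i * v.repr x j * N (v i) (v j) := by
    intro x
    conv_lhs => rw [← v.sum_repr x]
    simp only [map_sum, LinearMap.sum_apply, map_smul, LinearMap.smul_apply, smul_eq_mul]
    simp only [Finset.mul_sum]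
    rw [Finset.sum_comm]
    refine Finset.sum_congr rfl fun i _ => Finset.sum_congr rfl fun j _ => ?_
    ring
  have hzero : ∀ i, B (v i) (v i) = 0 → N (v i) = 0 := by
    intro i hi
    refine hker _ (v.ext fun j => ?_)
    by_cases hij : i = j
    · subst hij
      simpa using hi
    · simpa using (show B (v i) (v j) = 0 from hv hij)
  have hcoord : ∀ x i, B (v i) (v i) ≠ 0 →
      v.repr x i ^ 2 ≤ (B (v i) (v i))⁻¹ * B x x := by
    intro x i hi
    have hle : v.repr x i ^ 2 * B (v i) (v i) ≤ B x x := by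
      rw [hdiag x]
      exact Finset.single_le_sum (f := fun i => v.repr x i ^ 2 * B (v i) (v i))
        (fun j _ => mul_nonneg (sq_nonneg _) (hpos _)) (Finset.mem_univ i)
    have hlt : 0 < B (v i) (v i) := lt_of_le_of_ne (hpos _) (Ne.symm hi)
    rw [inv_mul_eq_div, le_div_iff₀ hlt]
    exact hle
  refine ⟨∑ i, ∑ j, |N (v i) (v j)| * ((B (v i) (v i))⁻¹ + (B (v j) (v j))⁻¹), ?_, ?_⟩
  · exact Finset.sum_nonneg fun i _ => Finset.sum_nonneg fun j _ =>
      mul_nonneg (abs_nonneg _) (add_nonneg (inv_nonneg.2 (hpos _)) (inv_nonneg.2 (hpos _)))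
  · intro x
    rw [hexp x, Finset.sum_mul]
    refine (Finset.abs_sum_le_sum_abs _ _).trans (Finset.sum_le_sum fun i _ => ?_)
    rw [Finset.sum_mul]
    refine (Finset.abs_sum_le_sum_abs _ _).trans (Finset.sum_le_sum fun j _ => ?_)
    by_cases hi : B (v i) (v i) = 0
    · simp [hzero i hi]
    by_cases hj : B (v j) (v j) = 0
    · have h0 : N (v i) (v j) = 0 := by rw [← hN.eq]; simp [hzero j hj]
      simp [h0]
    rw [abs_mul, mul_comm, mul_assoc]
    refine mul_le_mul_of_nonneg_left ?_ (abs_nonneg _)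
    have h1 := hcoord x i hi
    have h2 := hcoord x j hj
    rw [abs_mul]
    nlinarith [sq_nonneg (|v.repr x i| - |v.repr x j|), sq_abs (v.repr x i),
      sq_abs (v.repr x j), sq_nonneg (v.repr x i), sq_nonneg (v.repr x j)]

/-- The linear form with prescribed coefficients. -/
def linForm (n : ℕ) : (Fin (n + 1) → ℝ) →ₗ[ℝ] PolyS n :=
  Fintype.linearCombination ℝ (X : Fin (n + 1) → PolyS n)

lemma linForm_injective (n : ℕ) : Function.Injective (linForm n) :=
  (linearIndependent_X (Fin (n + 1)) ℝ).fintypeLinearCombination_injective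

lemma range_linForm (n : ℕ) :
    LinearMap.range (linForm n) = homogeneousSubmodule (Fin (n + 1)) ℝ 1 := by
  rw [linForm, Fintype.range_linearCombination, homogeneousSubmodule_one_eq_span_X]

lemma linForm_isHomogeneous {n : ℕ} (a : Fin (n + 1) → ℝ) : (linForm n a).IsHomogeneous 1 := by
  rw [← mem_homogeneousSubmodule, ← range_linForm]
  exact LinearMap.mem_range_self _ a

lemma exists_linForm_eq {n : ℕ} {f : PolyS n} (hf : f.IsHomogeneous 1) :
    ∃ a, linForm n a = f := by
  rwa [← mem_homogeneousSubmodule, ← range_linForm] at hf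

/-- The matrix of `B_ℓ` in the basis of the variables. -/
def hankelMatrix {n : ℕ} (l : S2 n →ₗ[ℝ] ℝ) : Matrix (Fin (n + 1)) (Fin (n + 1)) ℝ :=
  Matrix.of fun i j => l ⟨X i * X j, XX_mem_S2 i j⟩

lemma hankelMatrix_apply {n : ℕ} (l : S2 n →ₗ[ℝ] ℝ) (i j : Fin (n + 1)) :
    hankelMatrix l i j = l ⟨X i * X j, XX_mem_S2 i j⟩ := rfl

/-- The bilinear form `B_ℓ`, in the coordinates given by the variables. -/
def hankelForm {n : ℕ} (l : S2 n →ₗ[ℝ] ℝ) : LinearMap.BilinForm ℝ (Fin (n + 1) → ℝ) :=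
  Matrix.toBilin' (hankelMatrix l)

lemma hankelForm_apply {n : ℕ} (l : S2 n →ₗ[ℝ] ℝ) (a b : Fin (n + 1) → ℝ)
    (h : linForm n a * linForm n b ∈ S2 n) :
    hankelForm l a b = l ⟨linForm n a * linForm n b, h⟩ := by
  have hq : (⟨linForm n a * linForm n b, h⟩ : S2 n) =
      ∑ i, ∑ j, (a i * b j) • (⟨X i * X j, XX_mem_S2 i j⟩ : S2 n) := by
    apply Subtype.ext
    simp only [linForm, Fintype.linearCombination_apply, Finset.sum_mul_sum,
      Submodule.coe_sum, Submodule.coe_smul, smul_mul_smul_comm]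
  rw [hq, hankelForm, Matrix.toBilin'_apply]
  simp only [map_sum, map_smul, smul_eq_mul, hankelMatrix_apply]
  refine Finset.sum_congr rfl fun i _ => Finset.sum_congr rfl fun j _ => ?_
  ring

lemma hankelForm_isSymm {n : ℕ} (l : S2 n →ₗ[ℝ] ℝ) :
    LinearMap.IsSymm (hankelForm l) := by
  refine ⟨fun a b => ?_⟩
  have hmem : ∀ a b, linForm n a * linForm n b ∈ S2 n := fun a b =>
    (linForm_isHomogeneous a).mul (linForm_isHomogeneous b)
  rw [RingHom.id_apply, hankelForm_apply l a b (hmem a b), hankelForm_apply l b a (hmem b a)]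
  simp only [mul_comm]

/-- A functional that vanishes on `I_2` and whose bilinear form vanishes on the kernel of `B_ℓ` is
a multiple of `ℓ` when `ℓ` spans an extreme ray. -/
lemma IsExtremeIn.exists_eq_smul {n : ℕ} {I : Ideal (PolyS n)} {l m : S2 n →ₗ[ℝ] ℝ}
    (hl : IsExtremeIn (SigmaStar I) l) (hm : ∀ q : S2 n, (q : PolyS n) ∈ I → m q = 0)
    (hker : ∀ a, hankelForm l a = 0 → hankelForm m a = 0) : ∃ c : ℝ, m = c • l := by
  obtain ⟨⟨hlI, hlpos⟩, -, hext⟩ := hl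
  have hpos : ∀ a, 0 ≤ hankelForm l a a := fun a => by
    rw [hankelForm_apply l a a (sq_mem_S2 (linForm_isHomogeneous a))]
    exact hlpos _ (linForm_isHomogeneous a)
  obtain ⟨K, hK, hbound⟩ := exists_abs_le_mul_of_ker_le (hankelForm l) (hankelForm m)
    (hankelForm_isSymm l) hpos (hankelForm_isSymm m) hker
  have hmem : ∀ t : ℝ, |t| ≤ 1 → l + (t / (K + 1)) • m ∈ SigmaStar I := by
    intro t ht
    refine ⟨fun q hq => by simp [hlI q hq, hm q hq], fun f hf => ?_⟩
    obtain ⟨a, rfl⟩ := exists_linForm_eq hf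
    have hb := hbound a
    have hp := hpos a
    rw [hankelForm_apply l a a (sq_mem_S2 hf)] at hb hp
    rw [hankelForm_apply m a a (sq_mem_S2 hf)] at hb
    simp only [LinearMap.add_apply, LinearMap.smul_apply, smul_eq_mul]
    set u := l ⟨linForm n a * linForm n a, sq_mem_S2 hf⟩
    set w := m ⟨linForm n a * linForm n a, sq_mem_S2 hf⟩
    have hle : |t / (K + 1) * w| ≤ u := by
      rw [abs_mul, abs_div, abs_of_pos (by linarith : 0 < K + 1), div_mul_eq_mul_div,
        div_le_iff₀ (by linarith)]
      nlinarith [abs_nonneg w, abs_nonneg t]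
    linarith [neg_abs_le (t / (K + 1) * w)]
  have hhalf : ∀ k ∈ SigmaStar I, (1 / 2 : ℝ) • k ∈ SigmaStar I := fun _ h =>
    ⟨fun q hq => by simp [h.1 q hq], fun f hf => by
      simpa using h.2 f hf⟩
  obtain ⟨⟨c, -, hc⟩, -⟩ := hext _ (hhalf _ (hmem 1 (by simp))) _ (hhalf _ (hmem (-1) (by simp)))
    (by ext q; simp; ring)
  refine ⟨(2 * c - 1) * (K + 1), ?_⟩
  ext q
  have hq := congrArg (fun f : S2 n →ₗ[ℝ] ℝ => f q) hc
  simp only [LinearMap.add_apply, LinearMap.smul_apply, smul_eq_mul] at hq ⊢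
  field_simp at hq
  linarith

/-- If `B_ℓ` vanishes on `W` against all linear forms, then `ℓ` vanishes on the degree-two part of
the ideal generated by `W`. -/
lemma apply_eq_zero_of_mem_span {n : ℕ} (l : S2 n →ₗ[ℝ] ℝ)
    {s : PolyS n} (hs : s ∈ Ideal.span
      (((LinearMap.ker (hankelForm l)).map (linForm n) : Submodule ℝ (PolyS n)) : Set (PolyS n)))
    (h2 : s ∈ S2 n) : l ⟨s, h2⟩ = 0 := by
  let L : PolyS n →ₗ[ℝ] ℝ := l ∘ₗ
    (homogeneousComponent 2).codRestrict (S2 n) fun q => homogeneousComponent_mem 2 q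
  have hL : ∀ q (hq : q ∈ S2 n), L q = l ⟨q, hq⟩ := fun q hq => by
    refine congrArg l (Subtype.ext ?_)
    exact homogeneousComponent_eq_self hq
  rw [← hL]
  have hmul : ∀ r : PolyS n, ∀ a, hankelForm l a = 0 → L (r * linForm n a) = 0 := by
    intro r a ha
    rw [← sum_homogeneousComponent r, Finset.sum_mul, map_sum]
    refine Finset.sum_eq_zero fun d _ => ?_
    have hd := (homogeneousComponent_isHomogeneous d r).mul (linForm_isHomogeneous a)
    by_cases h1 : d = 1
    · subst h1
      obtain ⟨b, hb⟩ := exists_linForm_eq (homogeneousComponent_isHomogeneous 1 r)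
      rw [hL _ hd]
      simp only [← hb] at hd ⊢
      rw [← hankelForm_apply, ← (hankelForm_isSymm l).eq, ha]
      simp
    · have h0 : homogeneousComponent 2 (homogeneousComponent d r * linForm n a) = 0 := by
        rw [homogeneousComponent_of_mem hd, if_neg (by omega)]
      have hz : (⟨_, homogeneousComponent_mem 2 (homogeneousComponent d r * linForm n a)⟩ : S2 n)
          = 0 := Subtype.ext h0
      exact (congrArg l hz).trans (map_zero l)
  refine Submodule.span_induction (p := fun q _ => ∀ r : PolyS n, L (r * q) = 0)
    ?_ ?_ ?_ ?_ hs 1 |> fun h => by simpa using h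
  · rintro _ ⟨a, ha, rfl⟩ r
    exact hmul r a ha
  · simp
  · intro x y _ _ hx hy r
    rw [mul_add, map_add, hx, hy, add_zero]
  · intro c x _ hx r
    rw [smul_eq_mul, ← mul_assoc]
    exact hx _

lemma finrank_ker_hankelForm {n : ℕ} (l : S2 n →ₗ[ℝ] ℝ) :
    n + 1 ≤ Module.finrank ℝ ((LinearMap.ker (hankelForm l)).map (linForm n)) + rankL l := by
  have hle : LinearMap.ker (hankelMatrix l).mulVecLin ≤ LinearMap.ker (hankelForm l) := by
    intro a ha
    rw [LinearMap.mem_ker, Matrix.mulVecLin_apply] at ha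
    rw [LinearMap.mem_ker]
    refine LinearMap.ext fun b => ?_
    rw [← (hankelForm_isSymm l).eq]
    simp [hankelForm, Matrix.toBilin'_apply', ha]
  have h1 := LinearMap.finrank_range_add_finrank_ker (hankelMatrix l).mulVecLin
  have h2 := Submodule.finrank_mono hle
  rw [Module.finrank_fin_fun] at h1
  have h3 := (Submodule.equivMapOfInjective (linForm n) (linForm_injective n)
    (LinearMap.ker (hankelForm l))).finrank_eq
  change _ ≤ _ + Module.finrank ℝ (LinearMap.range (hankelMatrix l).mulVecLin)
  omega

/-- A nonzero real matrix proportional to `z zᵀ` for a complex vector `z` has rank one. -/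
lemma rank_eq_one_of_mul_eq {ι : Type*} [Fintype ι] {M : Matrix ι ι ℝ}
    {z : ι → ℂ} {c : ℂ} (hz : z ≠ 0) (h : ∀ i j, z i * z j = c * M i j) : M.rank = 1 := by
  obtain ⟨k, hk⟩ := Function.ne_iff.1 hz
  have hk0 : z k ≠ 0 := hk
  have hc : c ≠ 0 := fun h0 => mul_ne_zero hk0 hk0 (by rw [h, h0, zero_mul])
  have hM : M k k ≠ 0 := fun h0 => mul_ne_zero hk0 hk0 (by rw [h, h0]; simp)
  have hprod : ∀ i j, M i j * M k k = M i k * M k j := by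
    intro i j
    have hC : (c * c) * ((M i j * M k k : ℝ) : ℂ) = (c * c) * ((M i k * M k j : ℝ) : ℂ) := by
      push_cast
      linear_combination (-(z k * z k)) * h i j - c * M i j * h k k + (z k * z j) * h i k
        + c * M i k * h k j
    exact_mod_cast mul_left_cancel₀ (mul_ne_zero hc hc) hC
  have hvec : M = Matrix.vecMulVec (fun i => M i k) (fun j => M k j / M k k) := by
    ext i j
    rw [Matrix.vecMulVec_apply, ← mul_div_assoc, eq_div_iff hM, hprod]
  refine le_antisymm (by rw [hvec]; exact Matrix.rank_vecMulVec_le _ _) ?_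
  rw [Nat.one_le_iff_ne_zero]
  intro h0
  classical
  have hrange := Submodule.finrank_eq_zero.1 h0
  have hcol : M.mulVecLin (Pi.single k 1) = 0 := by
    rw [LinearMap.range_eq_bot.1 hrange, LinearMap.zero_apply]
  exact hM (by simpa using congrFun hcol k)

/-- The functional `q ↦ φ (q z)` on quadrics. -/
def evalFunctional {n : ℕ} (z : Fin (n + 1) → ℂ) (φ : ℂ →ₗ[ℝ] ℝ) : S2 n →ₗ[ℝ] ℝ :=
  φ ∘ₗ (aeval z : PolyS n →ₐ[ℝ] ℂ).toLinearMap ∘ₗ (S2 n).subtype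

lemma evalFunctional_apply {n : ℕ} (z : Fin (n + 1) → ℂ) (φ : ℂ →ₗ[ℝ] ℝ) (q : S2 n) :
    evalFunctional z φ q = φ (aeval z (q : PolyS n)) := rfl

/-- If the kernel of `B_ℓ` has a common zero on `V(I) ∖ {0}` and `ℓ` spans an extreme ray, then
`ℓ` has rank one. -/
lemma IsExtremeIn.rankL_eq_one {n : ℕ} {I : Ideal (PolyS n)} {l : S2 n →ₗ[ℝ] ℝ}
    (hl : IsExtremeIn (SigmaStar I) l) {z : Fin (n + 1) → ℂ} (hz : z ∈ VC I) (hz0 : z ≠ 0)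
    (hker : ∀ a, hankelForm l a = 0 → aeval z (linForm n a) = 0) : rankL l = 1 := by
  have hmult : ∀ φ : ℂ →ₗ[ℝ] ℝ, ∃ c : ℝ, evalFunctional z φ = c • l := by
    intro φ
    refine hl.exists_eq_smul (fun q hq => ?_) fun a ha => ?_
    · rw [evalFunctional_apply, hz _ hq, map_zero]
    · refine LinearMap.ext fun b => ?_
      rw [hankelForm_apply _ a _ ((linForm_isHomogeneous a).mul (linForm_isHomogeneous _)),
        evalFunctional_apply, map_mul, hker a ha]
      simp
  obtain ⟨c, hc⟩ := hmult Complex.reLm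
  obtain ⟨d, hd⟩ := hmult Complex.imLm
  refine rank_eq_one_of_mul_eq (z := z) (c := ⟨c, d⟩) hz0 fun i j => ?_
  have hre := congrArg (fun f : S2 n →ₗ[ℝ] ℝ => f ⟨X i * X j, XX_mem_S2 i j⟩) hc
  have him := congrArg (fun f : S2 n →ₗ[ℝ] ℝ => f ⟨X i * X j, XX_mem_S2 i j⟩) hd
  simp only [evalFunctional_apply, map_mul, aeval_X, LinearMap.smul_apply, smul_eq_mul,
    Complex.reLm_coe, Complex.imLm_coe] at hre him
  apply Complex.ext
  · rw [hre]; simp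
  · rw [him]; simp

/-- If `X = V(I)` satisfies the `p`-base-point-free property, then every extreme ray of
the Hankel cone `Σ*(I)` has rank `1` or rank at least `p + 1`. -/
theorem statement0 {n p : ℕ} (hn : 1 ≤ n) (hp : 1 ≤ p) (I : Ideal (PolyS n))
    (hhom : IsHomIdeal I)
    (hI1 : ∀ f ∈ I, f.IsHomogeneous 1 → f = 0)
    (hbpf : pBPF I p) :
    ∀ l : S2 n →ₗ[ℝ] ℝ, IsExtremeIn (SigmaStar I) l →
      rankL l = 1 ∨ p + 1 ≤ rankL l := by
  intro l hl
  by_contra! hcon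
  obtain ⟨hne, hlt⟩ := hcon
  have hrank := finrank_ker_hankelForm l
  refine hl.2.1 (LinearMap.ext fun q => ?_)
  obtain ⟨a, haI, ha2, hqa⟩ := hbpf ((LinearMap.ker (hankelForm l)).map (linForm n))
    (by rw [← range_linForm]; exact LinearMap.map_le_range) (by omega)
    (fun z hz hz0 => by
      by_contra! hw
      exact hne (hl.rankL_eq_one hz hz0 fun a ha => hw _ ⟨a, ha, rfl⟩)) q q.2
  have hq : q = ⟨a, ha2⟩ + ⟨(q : PolyS n) - a, (S2 n).sub_mem q.2 ha2⟩ := Subtype.ext (by simp)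
  rw [hq, map_add, hl.1.1 ⟨a, ha2⟩ haI, apply_eq_zero_of_mem_span l hqa]
  simp
end
end

section
/- Let I ⊆ S = ℝ[x_0,…,x_n] be a homogeneous ideal that equals the ideal of all polynomials vanishing on its real zero set Z(I). Suppose that every ℓ ∈ Σ*(I) is a finite nonnegative combination of point evaluations at points of Z(I). Let h ∈ S_1 be a nonzero linear form, let Z' = Z(I) ∩ { x ∈ ℝ^{n+1} : h(x) = 0 }, and let J ⊆ S be the ideal of all polynomials vanishing on Z'. Then every ℓ ∈ Σ*(J) is a finite nonnegative combination of point evaluations at points of Z'. -/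
open MvPolynomial

noncomputable section

/-- The real zero set `Z(I) ⊆ ℝ^{n+1}`. -/
def ZR {n : ℕ} (I : Ideal (PolyS n)) : Set (Fin (n + 1) → ℝ) :=
  { x | ∀ f ∈ I, aeval x f = 0 }

/-- Evaluation at a real point, as a linear functional on `S_2`. -/
def evQ {n : ℕ} (x : Fin (n + 1) → ℝ) : S2 n →ₗ[ℝ] ℝ :=
  (aeval x : PolyS n →ₐ[ℝ] ℝ).toLinearMap.comp (S2 n).subtype

/-- The real zero set of a homogeneous ideal contains the origin as soon as it is nonempty. -/
lemma zero_mem_ZR {n : ℕ} {I : Ideal (PolyS n)} (hhom : IsHomIdeal I)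
    {x : Fin (n + 1) → ℝ} (hx : x ∈ ZR I) : (0 : Fin (n + 1) → ℝ) ∈ ZR I := by
  intro f hf
  have hcoeff := hx _ (hhom f hf 0)
  rw [homogeneousComponent_zero, aeval_C] at hcoeff
  simpa [constantCoeff_eq] using hcoeff

/-- If `I` is the vanishing ideal of `Z(I)`, every element of `Σ*(I)` is a finite nonnegative
combination of evaluations at points of `Z(I)`, `h ∈ S_1` is a nonzero linear form,
`Z' = Z(I) ∩ {h = 0}` and `J` is the vanishing ideal of `Z'`, then every element of `Σ*(J)`
is a finite nonnegative combination of evaluations at points of `Z'`. -/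
theorem statement4 {n : ℕ} (I : Ideal (PolyS n)) (hhom : IsHomIdeal I)
    (hvan : ∀ f : PolyS n, f ∈ I ↔ ∀ x ∈ ZR I, aeval x f = 0)
    (hsos : ∀ l ∈ SigmaStar I, ∃ (s : ℕ) (c : Fin s → ℝ) (x : Fin s → (Fin (n + 1) → ℝ)),
      (∀ i, 0 ≤ c i) ∧ (∀ i, x i ∈ ZR I) ∧ l = ∑ i, c i • evQ (x i))
    (h : PolyS n) (hh1 : h.IsHomogeneous 1) (hh0 : h ≠ 0)
    (Z' : Set (Fin (n + 1) → ℝ))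
    (hZ' : Z' = { x | x ∈ ZR I ∧ aeval x h = 0 })
    (J : Ideal (PolyS n))
    (hJ : ∀ f : PolyS n, f ∈ J ↔ ∀ x ∈ Z', aeval x f = 0) :
    ∀ l ∈ SigmaStar J, ∃ (s : ℕ) (c : Fin s → ℝ) (x : Fin s → (Fin (n + 1) → ℝ)),
      (∀ i, 0 ≤ c i) ∧ (∀ i, x i ∈ Z') ∧ l = ∑ i, c i • evQ (x i) := by
  intro l hl
  subst hZ'
  have hIJ : I ≤ J := fun f hf => (hJ f).2 fun x hx => hx.1 f hf
  obtain ⟨s, c, x, hc, hx, hlsum⟩ := hsos l ⟨fun q hq => hl.1 q (hIJ hq), hl.2⟩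
  have hlhh : l ⟨h * h, sq_mem_S2 hh1⟩ = 0 :=
    hl.1 _ ((hJ _).2 fun y hy => by rw [map_mul, hy.2, mul_zero])
  have hsum : ∑ i, c i * (aeval (x i) h * aeval (x i) h) = 0 := by
    rw [← hlhh, hlsum]
    simp [evQ]
  have hterm : ∀ i, c i = 0 ∨ aeval (x i) h = 0 := fun i => by
    have := (Finset.sum_eq_zero_iff_of_nonneg
      fun j _ => mul_nonneg (hc j) (mul_self_nonneg _)).1 hsum i (Finset.mem_univ i)
    simpa using this
  -- Points off the hyperplane carry weight zero, so they may be moved to the origin.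
  refine ⟨s, c, fun i => if c i = 0 then 0 else x i, hc, fun i => ?_, ?_⟩
  · by_cases hci : c i = 0
    · simp only [hci, if_true]
      refine ⟨zero_mem_ZR hhom (hx i), ?_⟩
      simpa [constantCoeff_eq] using hh1.coeff_eq_zero (d := 0) (by simp)
    · simp only [hci, if_false]
      exact ⟨hx i, (hterm i).resolve_left hci⟩
  · rw [hlsum]
    refine Finset.sum_congr rfl fun i _ => ?_
    by_cases hci : c i = 0 <;> simp [hci]
end
end

section
/- Let r, d, e, k be natural numbers with k ≤ d and k ≤ e, and set N = d + e − k. Let A be a real symmetric positive semidefinite d×d matrix with rank A ≤ r and let B be a real symmetric positive semidefinite e×e matrix with rank B ≤ r. Suppose the lower-right k×k principal block of A equals the upper-left k×k principal block of B, i.e., A_{(d−k+i),(d−k+j)} = B_{i,j} for all 1 ≤ i, j ≤ k. Then there exists a real symmetric positive semidefinite N×N matrix C with rank C ≤ r whose upper-left d×d principal block equals A and whose lower-right e×e principal block equals B. -/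
noncomputable section

/-- A family of vectors in a finite-dimensional inner product space is carried onto any other
family with the same Gram matrix by a linear isometry. -/
theorem exists_linearIsometry_of_inner_eq {ι V : Type*} [Fintype ι] [NormedAddCommGroup V]
    [InnerProductSpace ℝ V] [FiniteDimensional ℝ V] (u w : ι → V)
    (h : ∀ i j, inner ℝ (u i) (u j) = inner ℝ (w i) (w j)) :
    ∃ L : V →ₗᵢ[ℝ] V, ∀ i, L (u i) = w i := by
  classical
  let T := Fintype.linearCombination ℝ u
  let W := Fintype.linearCombination ℝ w
  have norm_eq (x : ι → ℝ) : ‖W x‖ = ‖T x‖ := by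
    rw [← sq_eq_sq₀ (norm_nonneg _) (norm_nonneg _), ← real_inner_self_eq_norm_sq,
      ← real_inner_self_eq_norm_sq]
    simp only [W, T, Fintype.linearCombination_apply, sum_inner, inner_sum, inner_smul_left,
      inner_smul_right, h]
  obtain ⟨s, hs⟩ := T.rangeRestrict.exists_rightInverse_of_surjective T.range_rangeRestrict
  have hs' (y : T.range) : T (s y) = y := congrArg Subtype.val (LinearMap.congr_fun hs y)
  let L : T.range →ₗᵢ[ℝ] V :=
    { toLinearMap := W ∘ₗ s
      norm_map' := fun y => by
        rw [LinearMap.comp_apply, norm_eq, hs', Submodule.coe_norm] }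
  refine ⟨L.extend, fun i => ?_⟩
  have hT : T (Pi.single i 1) = u i := by simp [T]
  have hW : W (Pi.single i 1) = w i := by simp [W]
  have hmem : u i ∈ T.range := ⟨_, hT⟩
  rw [L.extend_apply ⟨u i, hmem⟩]
  change W (s ⟨u i, hmem⟩) = w i
  rw [← hW, ← sub_eq_zero, ← map_sub, ← norm_eq_zero, norm_eq, map_sub, hs', hT, sub_self,
    norm_zero]

/-- An inner product space of dimension at most `r` embeds isometrically into `ℝ^r`. -/
theorem exists_linearIsometry_euclideanSpace {V : Type*} [NormedAddCommGroup V]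
    [InnerProductSpace ℝ V] [FiniteDimensional ℝ V] {r : ℕ} (h : Module.finrank ℝ V ≤ r) :
    Nonempty (V →ₗᵢ[ℝ] EuclideanSpace ℝ (Fin r)) := by
  let b := stdOrthonormalBasis ℝ V
  let f := b.toBasis.constr ℝ fun i => EuclideanSpace.basisFun (Fin r) ℝ (Fin.castLE h i)
  refine ⟨f.isometryOfOrthonormal (v := b.toBasis) (by simp) ?_⟩
  have hf : f ∘ b.toBasis = EuclideanSpace.basisFun (Fin r) ℝ ∘ Fin.castLE h := by
    ext1 i
    exact b.toBasis.constr_basis ℝ _ i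
  rw [hf]
  exact (EuclideanSpace.basisFun (Fin r) ℝ).orthonormal.comp _ (Fin.castLE_injective h)

/-- A real positive semidefinite matrix of rank at most `r` is a Gram matrix of vectors
in `ℝ^r`. -/
theorem Matrix.PosSemidef.exists_eq_gram {ι : Type*} [Fintype ι] {M : Matrix ι ι ℝ}
    (hM : M.PosSemidef) {r : ℕ} (hr : M.rank ≤ r) :
    ∃ v : ι → EuclideanSpace ℝ (Fin r), M = Matrix.gram ℝ v := by
  classical
  obtain ⟨R, rfl⟩ : ∃ R : Matrix ι ι ℝ, M = R.conjTranspose * R := by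
    open scoped MatrixOrder in
    exact CStarAlgebra.nonneg_iff_eq_star_mul_self.mp hM.nonneg
  rw [Matrix.rank_conjTranspose_mul_self] at hr
  let c : ι → EuclideanSpace ℝ ι := fun i => WithLp.toLp 2 (R.col i)
  let S := Submodule.span ℝ (Set.range c)
  have hS : Module.finrank ℝ S ≤ r := by
    rw [Matrix.rank_eq_finrank_span_cols] at hr
    have hmap : S = (Submodule.span ℝ (Set.range R.col)).map
        (WithLp.linearEquiv 2 ℝ (ι → ℝ)).symm.toLinearMap := by
      rw [Submodule.map_span, ← Set.range_comp]
      rfl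
    rw [hmap]
    exact (LinearEquiv.finrank_map_eq _ _).trans_le hr
  obtain ⟨f⟩ := exists_linearIsometry_euclideanSpace hS
  refine ⟨fun i => f ⟨c i, Submodule.subset_span ⟨i, rfl⟩⟩, ?_⟩
  ext i j
  rw [Matrix.gram_apply, f.inner_map_map, Submodule.coe_inner]
  simp [c, Matrix.mul_apply, PiLp.inner_apply, mul_comm]

/-- The rank of a Gram matrix of vectors in `ℝ^r` is at most `r`. -/
theorem Matrix.rank_gram_euclideanSpace_le {ι : Type*} [Fintype ι] {r : ℕ}
    (v : ι → EuclideanSpace ℝ (Fin r)) : (Matrix.gram ℝ v).rank ≤ r := by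
  let Z : Matrix (Fin r) ι ℝ := Matrix.of fun a i => v i a
  have hZ : Matrix.gram ℝ v = Z.transpose * Z := by
    ext i j
    simp [Z, Matrix.gram_apply, Matrix.mul_apply, PiLp.inner_apply, mul_comm]
  rw [hZ]
  exact (Matrix.rank_mul_le_right _ _).trans (Z.rank_le_card_height.trans_eq (Fintype.card_fin r))

/-- Two positive semidefinite matrices of rank at most `r` that agree on a common
overlap of `k` coordinates admit a common positive semidefinite extension of rank at
most `r` (the matrix-theoretic content of the linear-joining theorem). -/
theorem statement6 (r d e k : ℕ) (hkd : k ≤ d) (hke : k ≤ e)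
    (A : Matrix (Fin d) (Fin d) ℝ) (B : Matrix (Fin e) (Fin e) ℝ)
    (hA : A.PosSemidef) (hB : B.PosSemidef)
    (hrA : A.rank ≤ r) (hrB : B.rank ≤ r)
    (hoverlap : ∀ i j : Fin k,
      A ⟨d - k + i.val, by omega⟩ ⟨d - k + j.val, by omega⟩ = B ⟨i.val, by omega⟩ ⟨j.val, by omega⟩) :
    ∃ C : Matrix (Fin (d + e - k)) (Fin (d + e - k)) ℝ,
      C.PosSemidef ∧ C.rank ≤ r ∧
      (∀ i j : Fin d, C ⟨i.val, by omega⟩ ⟨j.val, by omega⟩ = A i j) ∧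
      (∀ i j : Fin e, C ⟨d - k + i.val, by omega⟩ ⟨d - k + j.val, by omega⟩ = B i j) := by
  obtain ⟨v, rfl⟩ := hA.exists_eq_gram hrA
  obtain ⟨w, rfl⟩ := hB.exists_eq_gram hrB
  obtain ⟨L, hL⟩ := exists_linearIsometry_of_inner_eq
    (fun i : Fin k => w ⟨i.val, by omega⟩) (fun i : Fin k => v ⟨d - k + i.val, by omega⟩)
    fun i j => (hoverlap i j).symm
  let z : Fin (d + e - k) → EuclideanSpace ℝ (Fin r) := fun n =>
    if h : n.val < d then v ⟨n.val, h⟩ else L (w ⟨n.val - (d - k), by omega⟩)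
  have hzv (i : Fin d) : z ⟨i.val, by omega⟩ = v i := by simp [z]
  have hzw (i : Fin e) : z ⟨d - k + i.val, by omega⟩ = L (w i) := by
    by_cases h : d - k + i.val < d
    · simp only [z, h, dite_true]
      exact (hL ⟨i.val, by omega⟩).symm
    · simp [z, h]
  refine ⟨Matrix.gram ℝ z, Matrix.posSemidef_gram ℝ z, Matrix.rank_gram_euclideanSpace_le z,
    fun i j => ?_, fun i j => ?_⟩
  · rw [Matrix.gram_apply, Matrix.gram_apply, hzv, hzv]
  · rw [Matrix.gram_apply, Matrix.gram_apply, hzw, hzw, L.inner_map_map]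
end
end

section
/- Let L be a linear subspace of the space of real symmetric N×N matrices and let C = L ∩ S_+ be the corresponding spectrahedral cone, where S_+ is the cone of positive semidefinite matrices. Let A ∈ C and suppose that every matrix spanning an extreme ray of C either has rank 1 or has rank strictly greater than rank A. Then A is a finite sum of rank-one positive semidefinite matrices belonging to C. -/
noncomputable section

/-- `A` spans an extreme ray of the convex cone `C` of matrices. -/
def SpansExtremeRay {V : Type*} (C : Set (Matrix V V ℝ)) (A : Matrix V V ℝ) : Prop :=
  A ∈ C ∧ A ≠ 0 ∧ ∀ B ∈ C, ∀ B' ∈ C, A = B + B' →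
    (∃ c : ℝ, 0 ≤ c ∧ B = c • A) ∧ ∃ c : ℝ, 0 ≤ c ∧ B' = c • A

open Matrix

namespace Matrix

variable {n : Type*} [Fintype n]

/-- Enlarging the kernel strictly makes the rank drop strictly. -/
theorem rank_lt_rank_of_ker_lt {M P : Matrix n n ℝ}
    (h : LinearMap.ker M.mulVecLin < LinearMap.ker P.mulVecLin) : P.rank < M.rank := by
  have hM := M.mulVecLin.finrank_range_add_finrank_ker
  have hP := P.mulVecLin.finrank_range_add_finrank_ker
  have hlt := Submodule.finrank_lt_finrank_of_lt h
  unfold rank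
  omega

/-- Each of two positive semidefinite matrices vanishes where their sum does. -/
theorem PosSemidef.mulVec_eq_zero_of_add {B B' : Matrix n n ℝ} (hB : B.PosSemidef)
    (hB' : B'.PosSemidef) {v : n → ℝ} (hv : (B + B') *ᵥ v = 0) : B *ᵥ v = 0 := by
  rw [← hB.dotProduct_mulVec_zero_iff]
  have h : star v ⬝ᵥ (B + B') *ᵥ v = 0 := by rw [hv, dotProduct_zero]
  rw [add_mulVec, dotProduct_add] at h
  linarith [hB.dotProduct_mulVec_nonneg v, hB'.dotProduct_mulVec_nonneg v]

/-- A positive semidefinite matrix of rank one is `x xᵀ` for some nonzero `x`. -/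
theorem PosSemidef.exists_eq_vecMulVec_of_rank_eq_one {M : Matrix n n ℝ} (hM : M.PosSemidef)
    (hrank : M.rank = 1) : ∃ x : n → ℝ, x ≠ 0 ∧ M = vecMulVec x x := by
  classical
  have hsymm : Mᵀ = M := by simpa [IsHermitian, conjTranspose_eq_transpose_of_trivial] using hM.1
  have hM0 : M ≠ 0 := by rintro rfl; simp at hrank
  obtain ⟨v, hv⟩ : ∃ v, M *ᵥ v ≠ 0 := by
    by_contra! h
    exact hM0 (ext_of_mulVec_single fun i => by rw [h, zero_mulVec])
  have hc : 0 < v ⬝ᵥ M *ᵥ v := by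
    refine lt_of_le_of_ne (by simpa using hM.dotProduct_mulVec_nonneg v) fun h => hv ?_
    rw [← hM.dotProduct_mulVec_zero_iff]
    simpa using h.symm
  set c := v ⬝ᵥ M *ᵥ v
  have hs : √c ≠ 0 := (Real.sqrt_pos.2 hc).ne'
  refine ⟨(√c)⁻¹ • M *ᵥ v, smul_ne_zero (inv_ne_zero hs) hv, ext_of_mulVec_single fun i => ?_⟩
  have hspan := (finrank_eq_one_iff_of_nonzero'
    (⟨M *ᵥ v, v, rfl⟩ : LinearMap.range M.mulVecLin) (fun h => hv (congrArg Subtype.val h))).1 hrank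
  obtain ⟨a, ha⟩ := hspan ⟨M *ᵥ Pi.single i 1, _, rfl⟩
  replace ha : a • M *ᵥ v = M *ᵥ Pi.single i 1 := congrArg Subtype.val ha
  have hpair : M *ᵥ v ⬝ᵥ Pi.single i 1 = a * c := by
    rw [← smul_eq_mul, ← dotProduct_smul, ha, dotProduct_mulVec, ← mulVec_transpose, hsymm]
  rw [vecMulVec_mulVec, smul_dotProduct, hpair, ← ha]
  ext j
  have hsq : √c * √c = c := Real.mul_self_sqrt hc.le
  simp only [Pi.smul_apply, smul_eq_mul, MulOpposite.smul_eq_mul_unop, MulOpposite.unop_op]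
  field_simp
  rw [pow_two, hsq]

/-- Moving from a positive semidefinite `M` against a nonzero positive semidefinite `B` that
vanishes on the kernel of `M`, one stays in the cone until the rank drops. -/
theorem PosSemidef.exists_sub_smul_rank_lt {M B : Matrix n n ℝ} (hM : M.PosSemidef)
    (hB : B.PosSemidef) (hB0 : B ≠ 0) (hker : ∀ v, M *ᵥ v = 0 → B *ᵥ v = 0) :
    ∃ t : ℝ, 0 ≤ t ∧ (M - t • B).PosSemidef ∧ (M - t • B).rank < M.rank := by
  classical
  obtain ⟨K, hK⟩ := Submodule.exists_isCompl (LinearMap.ker M.mulVecLin)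
  have hdecomp : ∀ x : n → ℝ, ∃ y ∈ K, ∃ z, x = z + y ∧ M *ᵥ z = 0 ∧ B *ᵥ z = 0 := by
    intro x
    obtain ⟨z, hz, y, hy, rfl⟩ := Submodule.mem_sup.1
      (hK.sup_eq_top ▸ Submodule.mem_top : x ∈ LinearMap.ker M.mulVecLin ⊔ K)
    exact ⟨y, hy, z, rfl, hz, hker z hz⟩
  have hpos : ∀ y ∈ K, y ≠ 0 → 0 < y ⬝ᵥ M *ᵥ y := by
    intro y hy hy0
    refine lt_of_le_of_ne (by simpa using hM.dotProduct_mulVec_nonneg y) fun h => hy0 ?_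
    have hMy : M *ᵥ y = 0 := by
      rw [← hM.dotProduct_mulVec_zero_iff]
      simpa using h.symm
    exact Submodule.disjoint_def.1 hK.disjoint y hMy hy
  obtain ⟨w, hwK, hw⟩ : ∃ w ∈ K, B *ᵥ w ≠ 0 := by
    by_contra! h
    refine hB0 (ext_of_mulVec_single fun i => ?_)
    obtain ⟨y, hy, z, hzy, -, hBz⟩ := hdecomp (Pi.single i 1)
    rw [hzy, mulVec_add, hBz, h y hy, add_zero, zero_mulVec]
  have hw0 : w ≠ 0 := by rintro rfl; simp at hw
  have hquad : ∀ P : Matrix n n ℝ, Continuous fun x : K => (x : n → ℝ) ⬝ᵥ P *ᵥ (x : n → ℝ) := by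
    intro P
    fun_prop
  have : Nontrivial K := ⟨⟨w, hwK⟩, 0, by simpa [Subtype.ext_iff] using hw0⟩
  obtain ⟨x₀, hx₀, hmax⟩ := (isCompact_sphere (0 : K) 1).exists_isMaxOn
    (NormedSpace.sphere_nonempty.2 zero_le_one)
    (f := fun x : K => ((x : n → ℝ) ⬝ᵥ B *ᵥ (x : n → ℝ)) / ((x : n → ℝ) ⬝ᵥ M *ᵥ (x : n → ℝ)))
    (ContinuousOn.div (hquad B).continuousOn (hquad M).continuousOn fun x hx =>
      (hpos x x.2 (by rintro h; simp [Submodule.coe_eq_zero.1 h] at hx)).ne')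
  have hx₀0 : (x₀ : n → ℝ) ≠ 0 := by rintro h; simp [Submodule.coe_eq_zero.1 h] at hx₀
  have hf₀ := hpos x₀ x₀.2 hx₀0
  set f₀ := (x₀ : n → ℝ) ⬝ᵥ M *ᵥ (x₀ : n → ℝ)
  set g₀ := (x₀ : n → ℝ) ⬝ᵥ B *ᵥ (x₀ : n → ℝ)
  have hratio : ∀ y ∈ K, y ≠ 0 → (y ⬝ᵥ B *ᵥ y) * f₀ ≤ g₀ * (y ⬝ᵥ M *ᵥ y) := by
    intro y hy hy0
    have hny : ‖y‖ ≠ 0 := norm_ne_zero_iff.2 hy0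
    have h := hmax (show (⟨‖y‖⁻¹ • y, K.smul_mem _ hy⟩ : K) ∈ Metric.sphere 0 1 by
      simp [norm_smul, hny])
    simp only [Set.mem_ofPred_eq, mulVec_smul, dotProduct_smul, smul_dotProduct,
      smul_eq_mul] at h
    rw [mul_div_mul_left _ _ (inv_ne_zero hny), mul_div_mul_left _ _ (inv_ne_zero hny)] at h
    exact (div_le_div_iff₀ (hpos y hy hy0) hf₀).1 h
  have hg₀ : 0 < g₀ := by
    have hBw : 0 < w ⬝ᵥ B *ᵥ w := by
      refine lt_of_le_of_ne (by simpa using hB.dotProduct_mulVec_nonneg w) fun h => hw ?_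
      rw [← hB.dotProduct_mulVec_zero_iff]
      simpa using h.symm
    have := (mul_pos hBw hf₀).trans_le (hratio w hwK hw0)
    exact (pos_iff_pos_of_mul_pos this).2 (hpos w hwK hw0)
  have hform : ∀ y, y ⬝ᵥ (M - (f₀ / g₀) • B) *ᵥ y
      = y ⬝ᵥ M *ᵥ y - f₀ / g₀ * (y ⬝ᵥ B *ᵥ y) := by
    intro y
    simp [sub_mulVec, smul_mulVec]
  have hherm : (M - (f₀ / g₀) • B).IsHermitian :=
    hM.1.sub (hB.smul (div_pos hf₀ hg₀).le).1
  have hsymm : (M - (f₀ / g₀) • B)ᵀ = M - (f₀ / g₀) • B := by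
    simpa [IsHermitian, conjTranspose_eq_transpose_of_trivial] using hherm
  have hpsd : (M - (f₀ / g₀) • B).PosSemidef := by
    refine PosSemidef.of_dotProduct_mulVec_nonneg hherm fun x => ?_
    obtain ⟨y, hy, z, rfl, hMz, hBz⟩ := hdecomp x
    have hz : (M - (f₀ / g₀) • B) *ᵥ z = 0 := by simp [sub_mulVec, smul_mulVec, hMz, hBz]
    have hzy : z ⬝ᵥ (M - (f₀ / g₀) • B) *ᵥ y = 0 := by
      rw [dotProduct_mulVec, ← mulVec_transpose, hsymm, hz, zero_dotProduct]
    rw [star_trivial, mulVec_add, hz, zero_add, add_dotProduct, hzy, zero_add, hform]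
    by_cases hy0 : y = 0
    · simp [hy0]
    · rw [sub_nonneg, div_mul_eq_mul_div, div_le_iff₀ hg₀]
      linarith [hratio y hy hy0]
  refine ⟨f₀ / g₀, (div_pos hf₀ hg₀).le, hpsd, rank_lt_rank_of_ker_lt ?_⟩
  rw [SetLike.lt_iff_le_and_exists]
  refine ⟨fun z hz => ?_, x₀, ?_, fun h => hx₀0 ?_⟩
  · have hMz : M *ᵥ z = 0 := hz
    rw [LinearMap.mem_ker, mulVecLin_apply, sub_mulVec, smul_mulVec, hMz, hker z hMz, smul_zero,
      sub_zero]
  · rw [LinearMap.mem_ker, mulVecLin_apply, ← hpsd.dotProduct_mulVec_zero_iff, star_trivial, hform]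
    change f₀ - f₀ / g₀ * g₀ = 0
    field_simp
    ring
  · exact Submodule.disjoint_def.1 hK.disjoint _ h x₀.2

/-- If `M = B + B'` with `B`, `B'` positive semidefinite and `B` not a multiple of `M`, then `M`
is a sum of two positive semidefinite matrices of smaller rank in the span of `M` and `B`. -/
theorem PosSemidef.exists_add_rank_lt {M B B' : Matrix n n ℝ} (hB : B.PosSemidef)
    (hB' : B'.PosSemidef) (hM : M = B + B') (hmul : ∀ c : ℝ, B ≠ c • M) :
    ∃ P Q : Matrix n n ℝ, M = P + Q ∧ P.PosSemidef ∧ Q.PosSemidef ∧ P.rank < M.rank ∧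
      Q.rank < M.rank ∧ P ∈ Submodule.span ℝ {M, B} ∧ Q ∈ Submodule.span ℝ {M, B} := by
  have hMpsd : M.PosSemidef := hM ▸ hB.add hB'
  have hB0 : B ≠ 0 := fun h => hmul 0 (by simp [h])
  have hM0 : M ≠ 0 := by
    rintro rfl
    refine hB0 ((hB.trace_eq_zero_iff).1 ?_)
    have h := congrArg trace hM
    rw [trace_zero, trace_add] at h
    linarith [hB.trace_nonneg, hB'.trace_nonneg]
  have hker : ∀ v, M *ᵥ v = 0 → B *ᵥ v = 0 := fun v hv =>
    hB.mulVec_eq_zero_of_add hB' (hM ▸ hv)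
  obtain ⟨t, ht, hPpsd, hPrank⟩ := hMpsd.exists_sub_smul_rank_lt hB hB0 hker
  obtain ⟨s, hQpsd, hQrank⟩ : ∃ s : ℝ, (B - s • M).PosSemidef ∧ (B - s • M).rank < M.rank := by
    by_cases hBM : ∀ v, B *ᵥ v = 0 → M *ᵥ v = 0
    · obtain ⟨s, -, hs, hlt⟩ := hB.exists_sub_smul_rank_lt hMpsd hM0 hBM
      have hle : LinearMap.ker B.mulVecLin = LinearMap.ker M.mulVecLin :=
        le_antisymm (fun v hv => hBM v hv) (fun v hv => hker v hv)
      have h₁ := M.mulVecLin.finrank_range_add_finrank_ker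
      have h₂ := B.mulVecLin.finrank_range_add_finrank_ker
      refine ⟨s, hs, hlt.trans_le ?_⟩
      rw [hle] at h₂
      unfold rank
      omega
    · push Not at hBM
      obtain ⟨v, hv, hMv⟩ := hBM
      refine ⟨0, by simpa using hB, ?_⟩
      rw [zero_smul, sub_zero]
      exact rank_lt_rank_of_ker_lt
        (SetLike.lt_iff_le_and_exists.2 ⟨fun v hv => hker v hv, v, hv, hMv⟩)
  have hcomb : (1 - t * s) • M = (M - t • B) + t • (B - s • M) := by module
  have hQ0 : B - s • M ≠ 0 := fun h => hmul s (sub_eq_zero.1 h)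
  have htr : ∀ {X : Matrix n n ℝ}, X.PosSemidef → X ≠ 0 → 0 < X.trace := fun hX hX0 =>
    lt_of_le_of_ne hX.trace_nonneg fun h => hX0 (hX.trace_eq_zero_iff.1 h.symm)
  have ht0 : 0 < t := by
    refine lt_of_le_of_ne ht ?_
    rintro rfl
    simp at hPrank
  have hd : 0 < 1 - t * s := by
    have h := congrArg trace hcomb
    rw [trace_add, trace_smul, trace_smul, smul_eq_mul, smul_eq_mul] at h
    have h₁ := mul_pos ht0 (htr hQpsd hQ0)
    have h₂ := hPpsd.trace_nonneg
    exact (pos_iff_pos_of_mul_pos (by rw [h]; linarith)).2 (htr hMpsd hM0)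
  have hrank : ∀ (c : ℝ) (X : Matrix n n ℝ), (c • X).rank ≤ X.rank := by
    classical
    intro c X
    have := rank_mul_le_left X (c • (1 : Matrix n n ℝ))
    rwa [Matrix.mul_smul, Matrix.mul_one] at this
  have hMmem : M ∈ Submodule.span ℝ {M, B} := Submodule.subset_span (by simp)
  have hBmem : B ∈ Submodule.span ℝ {M, B} := Submodule.subset_span (by simp)
  refine ⟨(1 - t * s)⁻¹ • (M - t • B), (1 - t * s)⁻¹ • t • (B - s • M), ?_,
    hPpsd.smul (inv_pos.2 hd).le, (hQpsd.smul ht).smul (inv_pos.2 hd).le,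
    (hrank _ _).trans_lt hPrank, ((hrank _ _).trans (hrank _ _)).trans_lt hQrank,
    Submodule.smul_mem _ _ (Submodule.sub_mem _ hMmem (Submodule.smul_mem _ _ hBmem)),
    Submodule.smul_mem _ _ (Submodule.smul_mem _ _
      (Submodule.sub_mem _ hBmem (Submodule.smul_mem _ _ hMmem)))⟩
  rw [← smul_add, ← hcomb, smul_smul, inv_mul_cancel₀ hd.ne', one_smul]

/-- An element of a spectrahedral cone that is nonzero and does not span an extreme ray splits
into two elements of the cone of smaller rank. -/
theorem exists_add_rank_lt_of_not_spansExtremeRay {L : Submodule ℝ (Matrix n n ℝ)}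
    {M : Matrix n n ℝ} (hML : M ∈ L) (hM : M.PosSemidef) (hM0 : M ≠ 0)
    (hext : ¬ SpansExtremeRay {M : Matrix n n ℝ | M ∈ L ∧ M.PosSemidef} M) :
    ∃ P Q : Matrix n n ℝ, M = P + Q ∧ (P ∈ L ∧ P.PosSemidef) ∧ (Q ∈ L ∧ Q.PosSemidef) ∧
      P.rank < M.rank ∧ Q.rank < M.rank := by
  have hMtr : 0 < M.trace :=
    lt_of_le_of_ne hM.trace_nonneg fun h => hM0 (hM.trace_eq_zero_iff.1 h.symm)
  have hnonneg : ∀ {X : Matrix n n ℝ}, X.PosSemidef → ∀ c : ℝ, X = c • M → 0 ≤ c := by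
    rintro X hX c rfl
    have h := hX.trace_nonneg
    rw [trace_smul, smul_eq_mul] at h
    exact nonneg_of_mul_nonneg_left h hMtr
  obtain ⟨B, hBL, hB, B', hB', hsum, hmul⟩ : ∃ B ∈ L, B.PosSemidef ∧ ∃ B' : Matrix n n ℝ,
      B'.PosSemidef ∧ M = B + B' ∧ ∀ c : ℝ, B ≠ c • M := by
    by_contra! hcon
    refine hext ⟨⟨hML, hM⟩, hM0, fun B hB B' hB' hsum => ⟨?_, ?_⟩⟩
    · obtain ⟨c, hc⟩ := hcon B hB.1 hB.2 B' hB'.2 hsum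
      exact ⟨c, hnonneg hB.2 c hc, hc⟩
    · obtain ⟨c, hc⟩ := hcon B' hB'.1 hB'.2 B hB.2 (hsum.trans (add_comm _ _))
      exact ⟨c, hnonneg hB'.2 c hc, hc⟩
  obtain ⟨P, Q, hPQ, hP, hQ, hPr, hQr, hPm, hQm⟩ := hB.exists_add_rank_lt hB' hsum hmul
  have hspan : Submodule.span ℝ {M, B} ≤ L := by
    rw [Submodule.span_le]
    rintro X (rfl | rfl)
    exacts [hML, hBL]
  exact ⟨P, Q, hPQ, ⟨hspan hPm, hP⟩, ⟨hspan hQm, hQ⟩, hPr, hQr⟩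

end Matrix

/-- An element of a spectrahedral cone `C = L ∩ S_+` whose rank is smaller than the rank of
every extreme ray of `C` of rank at least `2` is a finite sum of rank-one positive
semidefinite matrices belonging to `C`. -/
theorem statement14 {N : ℕ} (L : Submodule ℝ (Matrix (Fin N) (Fin N) ℝ))
    (hL : ∀ A ∈ L, A.IsSymm)
    (A : Matrix (Fin N) (Fin N) ℝ)
    (hA : A ∈ {M : Matrix (Fin N) (Fin N) ℝ | M ∈ L ∧ M.PosSemidef})
    (hext : ∀ B : Matrix (Fin N) (Fin N) ℝ,
      SpansExtremeRay {M : Matrix (Fin N) (Fin N) ℝ | M ∈ L ∧ M.PosSemidef} B →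
      B.rank = 1 ∨ A.rank < B.rank) :
    ∃ (s : ℕ) (x : Fin s → (Fin N → ℝ)),
      (∀ i, x i ≠ 0 ∧
        Matrix.vecMulVec (x i) (x i) ∈ {M : Matrix (Fin N) (Fin N) ℝ | M ∈ L ∧ M.PosSemidef}) ∧
      A = ∑ i, Matrix.vecMulVec (x i) (x i) := by
  suffices h : ∀ (r : ℕ) (M : Matrix (Fin N) (Fin N) ℝ), M.rank = r → r ≤ A.rank →
      M ∈ L → M.PosSemidef → ∃ (s : ℕ) (x : Fin s → (Fin N → ℝ)),
        (∀ i, x i ≠ 0 ∧ Matrix.vecMulVec (x i) (x i) ∈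
          {M : Matrix (Fin N) (Fin N) ℝ | M ∈ L ∧ M.PosSemidef}) ∧
        M = ∑ i, Matrix.vecMulVec (x i) (x i) from h _ A rfl le_rfl hA.1 hA.2
  intro r
  induction r using Nat.strong_induction_on with
  | _ r ih =>
    rintro M rfl hle hML hM
    by_cases hM0 : M = 0
    · exact ⟨0, Fin.elim0, fun i => i.elim0, by simp [hM0]⟩
    by_cases hray : SpansExtremeRay {M : Matrix (Fin N) (Fin N) ℝ | M ∈ L ∧ M.PosSemidef} M
    · have hrank : M.rank = 1 := (hext M hray).resolve_right hle.not_gt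
      obtain ⟨x, hx, rfl⟩ := hM.exists_eq_vecMulVec_of_rank_eq_one hrank
      exact ⟨1, fun _ => x, fun _ => ⟨hx, hML, hM⟩, by simp⟩
    · obtain ⟨P, Q, hsum, hP, hQ, hPr, hQr⟩ :=
        Matrix.exists_add_rank_lt_of_not_spansExtremeRay hML hM hM0 hray
      obtain ⟨s, x, hx, hPx⟩ := ih _ hPr P rfl (hPr.le.trans hle) hP.1 hP.2
      obtain ⟨t, y, hy, hQy⟩ := ih _ hQr Q rfl (hQr.le.trans hle) hQ.1 hQ.2
      refine ⟨s + t, Fin.append x y, fun i => ?_, ?_⟩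
      · induction i using Fin.addCases with
        | left i => simpa only [Fin.append_left] using hx i
        | right i => simpa only [Fin.append_right] using hy i
      · simp only [Fin.sum_univ_add, Fin.append_left, Fin.append_right]
        rw [hsum, hPx, hQy]
end
end

section
/- Let I ⊆ S = ℝ[x_0,…,x_n] be a homogeneous ideal with real zero set Z(I) ⊆ ℝ^{n+1}, and let K = Z(I) ∩ S^n be the (compact, antipodally symmetric) intersection with the unit sphere. For k ≥ 0 let F_k ⊆ C(K, ℝ) be the set of restrictions to K of homogeneous polynomials of degree 2k; then F_k ⊆ F_{k+1}. Let (m_k)_{k≥0} be linear maps m_k : F_k → ℝ with m_{k+1} restricted to F_k equal to m_k for all k. Then there exists a finite Borel measure μ on K with m_k(f) = ∫_K f dμ for all k and all f ∈ F_k if and only if for every k and every f ∈ F_k with f ≥ 0 on K one has m_k(f) ≥ 0. Moreover, the measure is unique up to antipodal symmetry: any two such measures μ, ν satisfy ∫_K g dμ = ∫_K g dν for every continuous g : K → ℝ with g(−x) = g(x) for all x ∈ K. -/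
open MvPolynomial

noncomputable section

open MeasureTheory

/-- `K = Z(I) ∩ Sⁿ`, the intersection of the real zero set with the unit sphere. -/
def sphZ {n : ℕ} (I : Ideal (PolyS n)) : Set (Fin (n + 1) → ℝ) :=
  { x | x ∈ ZR I ∧ ∑ i, x i ^ 2 = 1 }

/-- The quadric `x_0² + … + x_n²`. -/
def normSqP (n : ℕ) : PolyS n := ∑ i, X i ^ 2

lemma normSqP_hom (n : ℕ) : (normSqP n).IsHomogeneous 2 := by
  apply MvPolynomial.IsHomogeneous.sum
  intro i _
  simpa using (isHomogeneous_X (R := ℝ) i).pow 2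

/-- Multiplication by `x_0² + … + x_n²`, mapping degree-`2k` forms to degree-`2(k+1)`
forms; it does not change the restriction of a form to the unit sphere. -/
def mulNormSq {n k : ℕ} (F : homogeneousSubmodule (Fin (n + 1)) ℝ (2 * k)) :
    homogeneousSubmodule (Fin (n + 1)) ℝ (2 * (k + 1)) :=
  ⟨(F : PolyS n) * normSqP n, by
    rw [mem_homogeneousSubmodule]
    have hF : (F : PolyS n).IsHomogeneous (2 * k) :=
      (mem_homogeneousSubmodule _ _).mp F.2
    have h : 2 * (k + 1) = 2 * k + 2 := by ring
    rw [h]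
    exact hF.mul (normSqP_hom n)⟩

/-- A positive linear functional on a space of continuous functions on a compact space
containing the constants is integration against a finite measure. The space of functions is
given as the range of a linear map `Φ`. -/
lemma exists_finiteMeasure_integral_eq {X V : Type*} [TopologicalSpace X] [T2Space X]
    [CompactSpace X] [MeasurableSpace X] [BorelSpace X] [AddCommGroup V] [Module ℝ V]
    (Φ : V →ₗ[ℝ] C(X, ℝ)) (L : V →ₗ[ℝ] ℝ) (hpos : ∀ v, 0 ≤ Φ v → 0 ≤ L v)
    (hone : ∃ v, Φ v = 1) :
    ∃ μ : Measure X, IsFiniteMeasure μ ∧ ∀ v, L v = ∫ x, Φ v x ∂μ := by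
  obtain ⟨s, hs⟩ := Φ.rangeRestrict.exists_rightInverse_of_surjective
    (LinearMap.range_eq_top.mpr Φ.surjective_rangeRestrict)
  have hs' (y : LinearMap.range Φ) : Φ (s y) = y :=
    congrArg Subtype.val (LinearMap.congr_fun hs y)
  have hker (v : V) (hv : Φ v = 0) : L v = 0 := by
    refine le_antisymm ?_ (hpos v hv.ge)
    have := hpos (-v) (by simp [hv])
    simpa using this
  obtain ⟨G, hGext, hGpos⟩ := riesz_extension (PointedCone.positive ℝ C(X, ℝ))
    ⟨LinearMap.range Φ, L ∘ₗ s⟩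
    (fun y hy ↦ hpos _ (by rw [hs']; exact hy))
    (fun y ↦ by
      obtain ⟨v, hv⟩ := hone
      refine ⟨⟨Φ (‖y‖ • v), LinearMap.mem_range_self _ _⟩, fun x ↦ ?_⟩
      have := (abs_le.mp (y.norm_coe_le_norm x)).1
      change 0 ≤ Φ (‖y‖ • v) x + y x
      simp only [map_smul, hv, ContinuousMap.smul_apply, ContinuousMap.one_apply, smul_eq_mul]
      linarith)
  let G' : CompactlySupportedContinuousMap X ℝ →ₗ[ℝ] ℝ :=
    { toFun f := G f.toContinuousMap
      map_add' f g := G.map_add f.toContinuousMap g.toContinuousMap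
      map_smul' c f := G.map_smul c f.toContinuousMap }
  let Λ := PositiveLinearMap.mk₀ G' (fun f hf ↦ hGpos _ hf)
  refine ⟨RealRMK.rieszMeasure Λ, inferInstance, fun v ↦ ?_⟩
  have hint := RealRMK.integral_rieszMeasure Λ
    ⟨Φ v, HasCompactSupport.of_compactSpace _⟩
  refine Eq.trans ?_ hint.symm
  change L v = G (Φ v)
  have hext := hGext ⟨Φ v, LinearMap.mem_range_self _ _⟩
  refine Eq.trans ?_ hext.symm
  change L v = L (s ⟨Φ v, _⟩)
  rw [← sub_eq_zero, ← map_sub]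
  exact hker _ (by rw [map_sub, hs', sub_self])

lemma aeval_neg_of_isHomogeneous {σ : Type*} {p : MvPolynomial σ ℝ} {d : ℕ}
    (hp : p.IsHomogeneous d) (x : σ → ℝ) : aeval (-x) p = (-1) ^ d * aeval x p := by
  simp only [aeval_def, eval₂_eq, Finset.mul_sum]
  refine Finset.sum_congr rfl fun m hm ↦ ?_
  have hdeg : m.degree = d := by
    rw [Finsupp.degree_eq_weight_one]
    exact hp (mem_support_iff.mp hm)
  have hprod : ∏ i ∈ m.support, (-x) i ^ m i = (-1) ^ d * ∏ i ∈ m.support, x i ^ m i := by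
    rw [← hdeg, Finsupp.degree_apply, ← Finset.prod_pow_eq_pow_sum, ← Finset.prod_mul_distrib]
    exact Finset.prod_congr rfl fun i _ ↦ by rw [Pi.neg_apply, neg_pow]
  rw [hprod]
  ring

lemma isCompact_sphZ {n : ℕ} (I : Ideal (PolyS n)) : IsCompact (sphZ I) := by
  have hclosed : IsClosed (sphZ I) := by
    have hZ : IsClosed (ZR I) := by
      simp only [ZR, Set.ofPred_forall]
      exact isClosed_iInter fun f ↦ isClosed_iInter fun _ ↦
        isClosed_eq f.continuous_eval continuous_const
    exact hZ.inter (isClosed_eq (by fun_prop) continuous_const)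
  refine Metric.isCompact_of_isClosed_isBounded hclosed ?_
  refine (Metric.isBounded_closedBall (x := (0 : Fin (n + 1) → ℝ)) (r := 1)).subset ?_
  rintro x ⟨-, hx⟩
  rw [mem_closedBall_zero_iff, pi_norm_le_iff_of_nonneg zero_le_one]
  intro i
  rw [Real.norm_eq_abs, ← sq_le_one_iff_abs_le_one, ← hx]
  exact Finset.single_le_sum (f := fun j ↦ x j ^ 2) (fun j _ ↦ sq_nonneg _) (Finset.mem_univ i)

instance compactSpace_sphZ {n : ℕ} (I : Ideal (PolyS n)) : CompactSpace (sphZ I) :=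
  isCompact_iff_compactSpace.mp (isCompact_sphZ I)

lemma neg_mem_sphZ {n : ℕ} {I : Ideal (PolyS n)} (hhom : IsHomIdeal I) {x : Fin (n + 1) → ℝ}
    (hx : x ∈ sphZ I) : -x ∈ sphZ I := by
  refine ⟨fun f hf ↦ ?_, by simpa using hx.2⟩
  rw [← sum_homogeneousComponent f, map_sum]
  refine Finset.sum_eq_zero fun d _ ↦ ?_
  rw [aeval_neg_of_isHomogeneous (homogeneousComponent_isHomogeneous d f),
    hx.1 _ (hhom f hf d), mul_zero]

/-- Restriction of polynomials to `K = Z(I) ∩ Sⁿ`. -/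
def restrictSphZ {n : ℕ} (I : Ideal (PolyS n)) : PolyS n →ₐ[ℝ] C(sphZ I, ℝ) :=
  aeval fun i ↦ ⟨fun x ↦ (x : Fin (n + 1) → ℝ) i,
    (continuous_apply i).comp continuous_subtype_val⟩

@[simp]
lemma restrictSphZ_apply {n : ℕ} (I : Ideal (PolyS n)) (p : PolyS n) (x : sphZ I) :
    restrictSphZ I p x = aeval (x : Fin (n + 1) → ℝ) p := by
  induction p using MvPolynomial.induction_on with
  | C a => simp [restrictSphZ]
  | add p q hp hq => simp [hp, hq]
  | mul_X p i hp =>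
    rw [map_mul, map_mul, ContinuousMap.mul_apply, hp]
    simp [restrictSphZ]

lemma restrictSphZ_mulNormSq {n : ℕ} (I : Ideal (PolyS n)) {k : ℕ}
    (F : homogeneousSubmodule (Fin (n + 1)) ℝ (2 * k)) :
    restrictSphZ I (mulNormSq F : PolyS n) = restrictSphZ I (F : PolyS n) := by
  ext x
  simp [mulNormSq, normSqP, x.2.2]

lemma restrictSphZ_range_separatesPoints {n : ℕ} (I : Ideal (PolyS n)) :
    (restrictSphZ I).range.SeparatesPoints := by
  intro x y hxy
  obtain ⟨i, hi⟩ := Function.ne_iff.mp (Subtype.coe_injective.ne hxy)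
  exact ⟨_, ⟨restrictSphZ I (X i), ⟨X i, rfl⟩, rfl⟩, by simpa using hi⟩

lemma integrable_continuousMap {X : Type*} [TopologicalSpace X] [CompactSpace X]
    [MeasurableSpace X] [BorelSpace X] (μ : Measure X) [IsFiniteMeasure μ] (g : C(X, ℝ)) :
    Integrable g μ :=
  g.continuous.integrable_of_hasCompactSupport (HasCompactSupport.of_compactSpace g)

section Moments

variable {n : ℕ} {I : Ideal (PolyS n)}
  {l : ∀ k : ℕ, homogeneousSubmodule (Fin (n + 1)) ℝ (2 * k) →ₗ[ℝ] ℝ}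

/-- A form of degree `2k` can be replaced by one of any larger even degree with the same
restriction to `K` and the same moment. -/
lemma exists_form_of_le
    (hcomp : ∀ (k : ℕ) (F : homogeneousSubmodule (Fin (n + 1)) ℝ (2 * k)),
      l (k + 1) (mulNormSq F) = l k F)
    {k j : ℕ} (hkj : k ≤ j) (F : homogeneousSubmodule (Fin (n + 1)) ℝ (2 * k)) :
    ∃ F' : homogeneousSubmodule (Fin (n + 1)) ℝ (2 * j),
      restrictSphZ I (F' : PolyS n) = restrictSphZ I (F : PolyS n) ∧ l j F' = l k F := by
  induction j, hkj using Nat.le_induction with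
  | base => exact ⟨F, rfl, rfl⟩
  | succ j _ ih =>
    obtain ⟨F', hF', hl⟩ := ih
    exact ⟨mulNormSq F', by rw [restrictSphZ_mulNormSq, hF'], by rw [hcomp, hl]⟩

/-- Restriction to `K` of formal sums of even-degree forms. -/
def restrictEvenForms (I : Ideal (PolyS n)) :
    (DirectSum ℕ fun k ↦ homogeneousSubmodule (Fin (n + 1)) ℝ (2 * k)) →ₗ[ℝ] C(sphZ I, ℝ) :=
  DirectSum.toModule ℝ ℕ _ fun k ↦
    (restrictSphZ I).toLinearMap ∘ₗ (homogeneousSubmodule (Fin (n + 1)) ℝ (2 * k)).subtype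

lemma restrictEvenForms_lof (k : ℕ) (F : homogeneousSubmodule (Fin (n + 1)) ℝ (2 * k)) :
    restrictEvenForms I
        (DirectSum.lof ℝ ℕ (fun k ↦ homogeneousSubmodule (Fin (n + 1)) ℝ (2 * k)) k F) =
      restrictSphZ I (F : PolyS n) := by
  rw [restrictEvenForms, DirectSum.toModule_lof]
  rfl

lemma exists_form_of_directSum
    (hcomp : ∀ (k : ℕ) (F : homogeneousSubmodule (Fin (n + 1)) ℝ (2 * k)),
      l (k + 1) (mulNormSq F) = l k F)
    (D : DirectSum ℕ fun k ↦ homogeneousSubmodule (Fin (n + 1)) ℝ (2 * k)) :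
    ∃ (k : ℕ) (F : homogeneousSubmodule (Fin (n + 1)) ℝ (2 * k)),
      restrictSphZ I (F : PolyS n) = restrictEvenForms I D ∧
        l k F = DirectSum.toModule ℝ ℕ ℝ l D := by
  induction D using DirectSum.induction_on with
  | zero => exact ⟨0, 0, by simp, by simp⟩
  | of k F =>
    rw [← DirectSum.lof_eq_of ℝ, restrictEvenForms_lof, DirectSum.toModule_lof]
    exact ⟨k, F, rfl, rfl⟩
  | add D E hD hE =>
    obtain ⟨k, F, hF, hlF⟩ := hD
    obtain ⟨j, G, hG, hlG⟩ := hE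
    obtain ⟨F', hF', hlF'⟩ := exists_form_of_le (I := I) hcomp (le_max_left k j) F
    obtain ⟨G', hG', hlG'⟩ := exists_form_of_le (I := I) hcomp (le_max_right k j) G
    refine ⟨max k j, F' + G', ?_, ?_⟩
    · rw [Submodule.coe_add, map_add, map_add, hF', hG', hF, hG]
    · rw [map_add, map_add, hlF', hlG', hlF, hlG]

lemma exists_measure_of_nonneg
    (hcomp : ∀ (k : ℕ) (F : homogeneousSubmodule (Fin (n + 1)) ℝ (2 * k)),
      l (k + 1) (mulNormSq F) = l k F)
    (hpos : ∀ (k : ℕ) (F : homogeneousSubmodule (Fin (n + 1)) ℝ (2 * k)),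
        (∀ x ∈ sphZ I, 0 ≤ aeval x (F : PolyS n)) → 0 ≤ l k F) :
    ∃ μ : Measure (sphZ I), IsFiniteMeasure μ ∧
      ∀ (k : ℕ) (F : homogeneousSubmodule (Fin (n + 1)) ℝ (2 * k)),
        l k F = ∫ x, aeval (x : Fin (n + 1) → ℝ) (F : PolyS n) ∂μ := by
  have hnonneg (D : DirectSum ℕ fun k ↦ homogeneousSubmodule (Fin (n + 1)) ℝ (2 * k))
      (hD : 0 ≤ restrictEvenForms I D) : 0 ≤ DirectSum.toModule ℝ ℕ ℝ l D := by
    obtain ⟨k, F, hF, hlF⟩ := exists_form_of_directSum (I := I) hcomp D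
    rw [← hlF]
    refine hpos k F fun x hx ↦ ?_
    rw [← restrictSphZ_apply I _ ⟨x, hx⟩, hF]
    exact hD ⟨x, hx⟩
  have hone : ∃ D, restrictEvenForms I D = 1 :=
    ⟨_, (restrictEvenForms_lof 0 ⟨1, isHomogeneous_one _ _⟩).trans (map_one _)⟩
  obtain ⟨μ, hμ, hint⟩ := exists_finiteMeasure_integral_eq
    (V := DirectSum ℕ fun k ↦ homogeneousSubmodule (Fin (n + 1)) ℝ (2 * k)) (restrictEvenForms I)
    (DirectSum.toModule ℝ ℕ ℝ l) hnonneg hone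
  refine ⟨μ, hμ, fun k F ↦ ?_⟩
  have hF := hint (DirectSum.lof ℝ ℕ _ k F)
  rw [DirectSum.toModule_lof, restrictEvenForms_lof] at hF
  simpa only [restrictSphZ_apply] using hF

/-- Two measures with the same even moments integrate the even part of every polynomial
in the same way. -/
lemma integral_evenPart_eq {μ ν : Measure (sphZ I)} [IsFiniteMeasure μ] [IsFiniteMeasure ν]
    (h : ∀ (k : ℕ) (F : homogeneousSubmodule (Fin (n + 1)) ℝ (2 * k)),
      ∫ x, aeval (x : Fin (n + 1) → ℝ) (F : PolyS n) ∂μ =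
        ∫ x, aeval (x : Fin (n + 1) → ℝ) (F : PolyS n) ∂ν)
    (p : PolyS n) :
    ∫ x : sphZ I, (aeval (x : Fin (n + 1) → ℝ) p + aeval (-(x : Fin (n + 1) → ℝ)) p) ∂μ =
      ∫ x : sphZ I, (aeval (x : Fin (n + 1) → ℝ) p + aeval (-(x : Fin (n + 1) → ℝ)) p) ∂ν := by
  have hsum (x : sphZ I) :
      aeval (x : Fin (n + 1) → ℝ) p + aeval (-(x : Fin (n + 1) → ℝ)) p =
        ∑ d ∈ Finset.range (p.totalDegree + 1),
          (1 + (-1) ^ d) * aeval (x : Fin (n + 1) → ℝ) (homogeneousComponent d p) := by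
    conv_lhs => rw [← sum_homogeneousComponent p]
    simp only [map_sum, ← Finset.sum_add_distrib]
    refine Finset.sum_congr rfl fun d _ ↦ ?_
    rw [aeval_neg_of_isHomogeneous (homogeneousComponent_isHomogeneous d p)]
    ring
  have hint (ρ : Measure (sphZ I)) [IsFiniteMeasure ρ] (q : PolyS n) :
      Integrable (fun x : sphZ I ↦ aeval (x : Fin (n + 1) → ℝ) q) ρ := by
    refine (integrable_continuousMap ρ (restrictSphZ I q)).congr (Filter.Eventually.of_forall ?_)
    exact restrictSphZ_apply I q
  simp only [hsum]
  rw [integral_finsetSum _ fun d _ ↦ (hint μ _).const_mul _,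
    integral_finsetSum _ fun d _ ↦ (hint ν _).const_mul _]
  refine Finset.sum_congr rfl fun d _ ↦ ?_
  rw [integral_const_mul, integral_const_mul]
  rcases Nat.even_or_odd' d with ⟨k, rfl | rfl⟩
  · rw [h k ⟨_, homogeneousComponent_mem (2 * k) p⟩]
  · simp [pow_succ]

lemma integral_eq_of_even {μ ν : Measure (sphZ I)} [IsFiniteMeasure μ] [IsFiniteMeasure ν]
    (hhom : IsHomIdeal I)
    (h : ∀ (k : ℕ) (F : homogeneousSubmodule (Fin (n + 1)) ℝ (2 * k)),
      ∫ x, aeval (x : Fin (n + 1) → ℝ) (F : PolyS n) ∂μ =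
        ∫ x, aeval (x : Fin (n + 1) → ℝ) (F : PolyS n) ∂ν)
    (g : C(sphZ I, ℝ))
    (hg : ∀ (x : sphZ I) (hx : -(x : Fin (n + 1) → ℝ) ∈ sphZ I),
      g ⟨-(x : Fin (n + 1) → ℝ), hx⟩ = g x) :
    ∫ x, g x ∂μ = ∫ x, g x ∂ν := by
  have hbound (ε : ℝ) (hε : 0 < ε) :
      |∫ x, g x ∂μ - ∫ x, g x ∂ν| ≤ ε * (μ.real Set.univ + ν.real Set.univ) := by
    obtain ⟨⟨_, p, rfl⟩, hp⟩ :=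
      ContinuousMap.exists_mem_subalgebra_near_continuousMap_of_separatesPoints _
        (restrictSphZ_range_separatesPoints I) g ε hε
    have hclose (x : sphZ I) : |aeval (x : Fin (n + 1) → ℝ) p - g x| ≤ ε := by
      simpa using ((restrictSphZ I p - g).norm_coe_le_norm x).trans hp.le
    let q : C(sphZ I, ℝ) := ⟨fun x ↦ aeval (x : Fin (n + 1) → ℝ) p +
      aeval (-(x : Fin (n + 1) → ℝ)) p,
        (p.continuous_eval.comp continuous_subtype_val).add
          (p.continuous_eval.comp continuous_subtype_val.neg)⟩
    have hq (x : sphZ I) : ‖q x - 2 * g x‖ ≤ 2 * ε := by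
      have h₁ := abs_le.mp (hclose x)
      have h₂ := abs_le.mp (hclose ⟨_, neg_mem_sphZ hhom x.2⟩)
      rw [hg] at h₂
      rw [Real.norm_eq_abs, abs_le]
      have hqx : q x = aeval (x : Fin (n + 1) → ℝ) p + aeval (-(x : Fin (n + 1) → ℝ)) p := rfl
      rw [hqx]
      constructor <;> linarith [h₁.1, h₁.2, h₂.1, h₂.2]
    have hdiff (ρ : Measure (sphZ I)) [IsFiniteMeasure ρ] :
        |∫ x, q x ∂ρ - 2 * ∫ x, g x ∂ρ| ≤ 2 * ε * ρ.real Set.univ := by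
      rw [← integral_const_mul, ← integral_sub (integrable_continuousMap ρ q)
        ((integrable_continuousMap ρ g).const_mul 2)]
      exact norm_integral_le_of_norm_le_const (Filter.Eventually.of_forall hq)
    have hμ := abs_le.mp (hdiff μ)
    have hν := abs_le.mp (hdiff ν)
    have heq : ∫ x, q x ∂μ = ∫ x, q x ∂ν := integral_evenPart_eq h p
    rw [abs_le]
    constructor <;> linarith [hμ.1, hμ.2, hν.1, hν.2]
  rw [← sub_eq_zero, ← abs_nonpos_iff]
  have hlim : Filter.Tendsto (fun ε : ℝ ↦ ε * (μ.real Set.univ + ν.real Set.univ))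
      (nhdsWithin 0 (Set.Ioi 0)) (nhds 0) :=
    tendsto_nhdsWithin_of_tendsto_nhds (Continuous.tendsto' (by fun_prop) _ _ (by simp))
  exact ge_of_tendsto hlim (Filter.eventually_of_mem self_mem_nhdsWithin hbound)

end Moments

/-- The moment problem on a real projective scheme: a compatible sequence of linear
functionals `m_k` on the spaces `F_k` of restrictions to `K = Z(I) ∩ Sⁿ` of forms of degree
`2k` comes from a finite Borel measure on `K` if and only if each `m_k` is nonnegative on
restrictions of forms nonnegative on `K`; moreover the measure is unique up to antipodal
symmetry. -/
theorem statement15 {n : ℕ} (I : Ideal (PolyS n)) (hhom : IsHomIdeal I)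
    (l : ∀ k : ℕ, homogeneousSubmodule (Fin (n + 1)) ℝ (2 * k) →ₗ[ℝ] ℝ)
    (hwd : ∀ k : ℕ, ∀ F F' : homogeneousSubmodule (Fin (n + 1)) ℝ (2 * k),
      (∀ x ∈ sphZ I, aeval x (F : PolyS n) = aeval x (F' : PolyS n)) → l k F = l k F')
    (hcomp : ∀ (k : ℕ) (F : homogeneousSubmodule (Fin (n + 1)) ℝ (2 * k)),
      l (k + 1) (mulNormSq F) = l k F) :
    ((∃ μ : Measure (sphZ I), IsFiniteMeasure μ ∧
        ∀ (k : ℕ) (F : homogeneousSubmodule (Fin (n + 1)) ℝ (2 * k)),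
          l k F = ∫ x, aeval (x : Fin (n + 1) → ℝ) (F : PolyS n) ∂μ) ↔
      (∀ (k : ℕ) (F : homogeneousSubmodule (Fin (n + 1)) ℝ (2 * k)),
        (∀ x ∈ sphZ I, 0 ≤ aeval x (F : PolyS n)) → 0 ≤ l k F)) ∧
    (∀ μ ν : Measure (sphZ I), IsFiniteMeasure μ → IsFiniteMeasure ν →
      (∀ (k : ℕ) (F : homogeneousSubmodule (Fin (n + 1)) ℝ (2 * k)),
        l k F = ∫ x, aeval (x : Fin (n + 1) → ℝ) (F : PolyS n) ∂μ) →
      (∀ (k : ℕ) (F : homogeneousSubmodule (Fin (n + 1)) ℝ (2 * k)),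
        l k F = ∫ x, aeval (x : Fin (n + 1) → ℝ) (F : PolyS n) ∂ν) →
      ∀ g : C(sphZ I, ℝ),
        (∀ (x : sphZ I) (hx : -(x : Fin (n + 1) → ℝ) ∈ sphZ I),
          g ⟨-(x : Fin (n + 1) → ℝ), hx⟩ = g x) →
        ∫ x, g x ∂μ = ∫ x, g x ∂ν) := by
  refine ⟨⟨?_, exists_measure_of_nonneg hcomp⟩, ?_⟩
  · rintro ⟨μ, -, hμ⟩ k F hF
    rw [hμ]
    exact integral_nonneg fun x ↦ hF x x.2
  · intro μ ν _ _ hμ hν g hg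
    exact integral_eq_of_even hhom (fun k F ↦ (hμ k F).symm.trans (hν k F)) g hg
end
end

section
/- Let I ⊆ S = ℝ[x_0,…,x_n] be a homogeneous ideal with real zero set Z(I) ⊆ ℝ^{n+1}, let k ≥ 1, and let ℓ : S_{2k} → ℝ be a linear functional on the space of homogeneous forms of degree 2k. Then the following are equivalent: (i) ℓ(F) ≥ 0 for every F ∈ S_{2k} with F(x) ≥ 0 for all x ∈ Z(I); (ii) there exist finitely many points x_1, …, x_s ∈ Z(I) and nonnegative reals c_1, …, c_s such that ℓ(F) = c_1·F(x_1) + … + c_s·F(x_s) for all F ∈ S_{2k}; in particular ℓ is then given by integration of F against a finite Borel measure supported on Z(I) ∩ S^n. -/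
open MvPolynomial

noncomputable section

open MeasureTheory

/-- The convex hull of a compact set in a finite-dimensional space is compact. -/
theorem isCompact_convexHull_of_finiteDimensional {E : Type*} [AddCommGroup E] [Module ℝ E]
    [TopologicalSpace E] [IsTopologicalAddGroup E] [ContinuousSMul ℝ E] [FiniteDimensional ℝ E]
    {s : Set E} (hs : IsCompact s) : IsCompact (convexHull ℝ s) := by
  have key : convexHull ℝ s = ⋃ m ∈ Set.Iic (Module.finrank ℝ E + 1),
      (fun p : (Fin m → ℝ) × (Fin m → E) => ∑ i, p.1 i • p.2 i) ''
        (stdSimplex ℝ (Fin m) ×ˢ Set.univ.pi fun _ => s) := by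
    ext y
    simp only [Set.mem_iUnion, Set.mem_image, Prod.exists, Set.mem_prod, Set.mem_univ_pi,
      Set.mem_Iic, exists_prop]
    constructor
    · intro hy
      obtain ⟨ι, _, z, w, hz, hind, hw, hw1, hy⟩ := eq_pos_convex_span_of_mem_convexHull hy
      let e := (Fintype.equivFin ι).symm
      refine ⟨Fintype.card ι,
        hind.card_le_finrank_succ.trans (by gcongr; exact Submodule.finrank_le _),
        w ∘ e, z ∘ e, ⟨⟨fun i => (hw _).le, ?_⟩, fun i => hz ⟨_, rfl⟩⟩, ?_⟩
      · rw [← hw1]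
        exact e.sum_comp w
      · rw [← hy]
        exact e.sum_comp fun i => w i • z i
    · rintro ⟨m, -, w, z, ⟨⟨hw, hw1⟩, hz⟩, rfl⟩
      exact mem_convexHull_of_exists_fintype w z hw hw1 hz rfl
  rw [key]
  refine (Set.finite_Iic _).isCompact_biUnion fun m _ => ?_
  refine ((isCompact_stdSimplex ℝ _).prod (isCompact_univ_pi fun _ => hs)).image ?_
  fun_prop

/-- Let `V` be a finite-dimensional space of functions, continuous on a compact set `K`, with a
member `g` equal to `1` on `K`. A functional on `V` that is nonnegative on the members
nonnegative on `K` is a finite nonnegative combination of evaluations at points of `K`. -/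
theorem exists_eq_sum_eval_of_nonneg {T V : Type*} [TopologicalSpace T] [AddCommGroup V]
    [Module ℝ V] [FiniteDimensional ℝ V] {K : Set T} (hK : IsCompact K) (φ : V →ₗ[ℝ] T → ℝ)
    (hφ : ∀ v, ContinuousOn (φ v) K) (g : V) (hg : ∀ x ∈ K, φ g x = 1) (l : V →ₗ[ℝ] ℝ)
    (hl : ∀ v, (∀ x ∈ K, 0 ≤ φ v x) → 0 ≤ l v) :
    ∃ (s : ℕ) (c : Fin s → ℝ) (x : Fin s → T),
      (∀ i, 0 ≤ c i) ∧ (∀ i, x i ∈ K) ∧ ∀ v, l v = ∑ i, c i * φ v (x i) := by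
  have hg0 : 0 ≤ l g := hl g fun x hx => by simp [hg x hx]
  rcases hg0.eq_or_lt with hg0 | hg0
  · have hle : ∀ v, 0 ≤ l v := by
      intro v
      obtain ⟨M, hM⟩ := hK.exists_bound_of_continuousOn (hφ v)
      have h := hl (M • g + v) fun x hx => by
        have := (abs_le.1 (hM x hx)).1
        simp only [map_add, map_smul, Pi.add_apply, Pi.smul_apply, hg x hx, smul_eq_mul]
        linarith
      simpa [← hg0] using h
    refine ⟨0, Fin.elim0, Fin.elim0, fun i => i.elim0, fun i => i.elim0, fun v => ?_⟩
    have := hle (-v)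
    rw [map_neg] at this
    simpa using le_antisymm (by linarith) (hle v)
  let b := Module.finBasis ℝ V
  let ev : T → (Fin (Module.finrank ℝ V) → ℝ) := fun x i => φ (b i) x
  have hev : ContinuousOn ev K := continuousOn_pi.2 fun i => hφ (b i)
  have hmem : (fun i => (l g)⁻¹ * l (b i)) ∈ convexHull ℝ (ev '' K) := by
    by_contra hnot
    obtain ⟨f, u, hfu, hu⟩ := geometric_hahn_banach_closed_point (convex_convexHull ℝ _)
      (isCompact_convexHull_of_finiteDimensional (hK.image_of_continuousOn hev)).isClosed hnot
    have hf : ∀ y, f y = ∑ i, y i * f (Pi.single i 1) := fun y => by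
      conv_lhs => rw [pi_eq_sum_univ' y]
      simp [map_sum]
    have h := hl (u • g - ∑ i, f (Pi.single i 1) • b i) fun x hx => by
      have h := hfu _ (subset_convexHull ℝ _ ⟨x, hx, rfl⟩)
      rw [hf] at h
      simp only [map_sub, map_sum, map_smul, Pi.sub_apply, Finset.sum_apply, Pi.smul_apply,
        hg x hx, smul_eq_mul]
      simp only [ev, mul_comm] at h ⊢
      linarith
    rw [hf] at hu
    have hu' : u * l g < ∑ i, f (Pi.single i 1) * l (b i) := by
      calc u * l g < (∑ i, (l g)⁻¹ * l (b i) * f (Pi.single i 1)) * l g := by gcongr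
        _ = _ := by
          rw [Finset.sum_mul]
          refine Finset.sum_congr rfl fun i _ => ?_
          field_simp
    simp only [map_sub, map_sum, map_smul, smul_eq_mul] at h
    linarith
  obtain ⟨ι, _, w, z, hw, -, hz, hsum⟩ := mem_convexHull_iff_exists_fintype.1 hmem
  choose x hxK hx using hz
  let e := (Fintype.equivFin ι).symm
  refine ⟨Fintype.card ι, fun i => l g * w (e i), fun i => x (e i),
    fun i => mul_nonneg hg0.le (hw _), fun i => hxK _, fun v => ?_⟩
  rw [e.sum_comp fun i => l g * w i * φ v (x i)]
  have hlin : l = ∑ i, (l g * w i) • (LinearMap.proj (x i) ∘ₗ φ) := by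
    refine b.ext fun j => ?_
    have h := congrFun hsum j
    simp only [Finset.sum_apply, Pi.smul_apply, ← hx, smul_eq_mul, ev] at h
    simp only [LinearMap.sum_apply, LinearMap.smul_apply, LinearMap.comp_apply,
      LinearMap.proj_apply, smul_eq_mul, mul_assoc]
    rw [← Finset.mul_sum, h]
    field_simp
  conv_lhs => rw [hlin]
  simp [LinearMap.sum_apply]

/-- Scaling the argument of a form of degree `d` by `t` multiplies its value by `t ^ d`. -/
theorem aeval_smul_of_isHomogeneous {n d : ℕ} {f : PolyS n} (hf : f.IsHomogeneous d) (t : ℝ)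
    (x : Fin (n + 1) → ℝ) : aeval (t • x) f = t ^ d * aeval x f := by
  simp only [aeval_def, eval₂_eq, Finset.mul_sum, Pi.smul_apply, smul_eq_mul, mul_pow,
    Finset.prod_mul_distrib, Finset.prod_pow_eq_pow_sum]
  refine Finset.sum_congr rfl fun m hm => ?_
  have : ∑ i ∈ m.support, m i = d := by
    rw [← hf (mem_support_iff.1 hm), Finsupp.weight_apply]
    simp [Finsupp.sum]
  rw [this]
  ring

/-- The real zero set of a homogeneous ideal is a cone. -/
theorem smul_mem_ZR {n : ℕ} {I : Ideal (PolyS n)} (hhom : IsHomIdeal I) (t : ℝ)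
    {x : Fin (n + 1) → ℝ} (hx : x ∈ ZR I) : t • x ∈ ZR I := by
  intro f hf
  rw [← sum_homogeneousComponent f, map_sum]
  refine Finset.sum_eq_zero fun d _ => ?_
  rw [aeval_smul_of_isHomogeneous (homogeneousComponent_isHomogeneous d f),
    hx _ (hhom f hf d), mul_zero]

theorem isClosed_ZR {n : ℕ} (I : Ideal (PolyS n)) : IsClosed (ZR I) := by
  have : ZR I = ⋂ f ∈ I, {x | eval x f = 0} := by
    ext x
    simp [ZR, aeval_eq_eval]
  rw [this]
  exact isClosed_biInter fun f _ => isClosed_eq f.continuous_eval continuous_const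

theorem isCompact_ZR_inter_sphere {n : ℕ} (I : Ideal (PolyS n)) :
    IsCompact {x | x ∈ ZR I ∧ ∑ i, x i ^ 2 = 1} := by
  refine Metric.isCompact_of_isClosed_isBounded
    ((isClosed_ZR I).inter (isClosed_eq (by fun_prop) continuous_const)) ?_
  refine (Metric.isBounded_closedBall (x := 0) (r := 1)).subset fun x hx => ?_
  rw [mem_closedBall_zero_iff, pi_norm_le_iff_of_nonneg zero_le_one]
  intro i
  rw [Real.norm_eq_abs, ← sq_le_one_iff_abs_le_one, ← hx.2]
  exact Finset.single_le_sum (fun j _ => sq_nonneg (x j)) (Finset.mem_univ i)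

/-- A form of positive even degree that is nonnegative on the unit vectors of `Z(I)` is
nonnegative on `Z(I)`. -/
theorem nonneg_on_ZR_of_nonneg_on_sphere {n k : ℕ} (hk : 1 ≤ k) {I : Ideal (PolyS n)}
    (hhom : IsHomIdeal I) {F : PolyS n} (hF : F.IsHomogeneous (2 * k))
    (h : ∀ x ∈ {x | x ∈ ZR I ∧ ∑ i, x i ^ 2 = 1}, 0 ≤ aeval x F) :
    ∀ x ∈ ZR I, 0 ≤ aeval x F := by
  intro x hx
  set r := √(∑ i, x i ^ 2)
  have hr2 : r ^ 2 = ∑ i, x i ^ 2 := Real.sq_sqrt (Finset.sum_nonneg fun i _ => sq_nonneg _)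
  by_cases hr : r = 0
  · have hx0 : x = (0 : ℝ) • x := by
      ext i
      have : ∑ i, x i ^ 2 = 0 := by rw [← hr2, hr]; norm_num
      have := (Finset.sum_eq_zero_iff_of_nonneg fun i _ => sq_nonneg (x i)).1 this i
        (Finset.mem_univ i)
      simpa using this
    rw [hx0, aeval_smul_of_isHomogeneous hF, zero_pow (by omega), zero_mul]
  · have hmem := h (r⁻¹ • x) ⟨smul_mem_ZR hhom _ hx, by
      simp only [Pi.smul_apply, smul_eq_mul, mul_pow]
      rw [← Finset.mul_sum, ← hr2]
      field_simp⟩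
    have hx1 : x = r • r⁻¹ • x := by rw [smul_inv_smul₀ hr]
    rw [hx1, aeval_smul_of_isHomogeneous hF, pow_mul]
    positivity

/-- A functional on the forms of degree `2k` that is nonnegative on those nonnegative on `Z(I)`
is a finite nonnegative combination of evaluations at unit vectors of `Z(I)`. -/
theorem exists_eq_sum_aeval_on_sphere {n : ℕ} (I : Ideal (PolyS n)) (hhom : IsHomIdeal I)
    (k : ℕ) (hk : 1 ≤ k) (l : homogeneousSubmodule (Fin (n + 1)) ℝ (2 * k) →ₗ[ℝ] ℝ)
    (hl : ∀ F : homogeneousSubmodule (Fin (n + 1)) ℝ (2 * k),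
      (∀ x ∈ ZR I, 0 ≤ aeval x (F : PolyS n)) → 0 ≤ l F) :
    ∃ (s : ℕ) (c : Fin s → ℝ) (x : Fin s → (Fin (n + 1) → ℝ)),
      (∀ i, 0 ≤ c i) ∧ (∀ i, x i ∈ {x | x ∈ ZR I ∧ ∑ i, x i ^ 2 = 1}) ∧
      ∀ F : homogeneousSubmodule (Fin (n + 1)) ℝ (2 * k),
        l F = ∑ i, c i * aeval (x i) (F : PolyS n) := by
  have : FiniteDimensional ℝ (homogeneousSubmodule (Fin (n + 1)) ℝ (2 * k)) :=
    Module.Finite.iff_fg.2 (homogeneousSubmodule_fg _ _ _)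
  have hg : ((∑ i, X i ^ 2 : PolyS n) ^ k).IsHomogeneous (2 * k) :=
    (IsHomogeneous.sum _ _ _ fun i _ => isHomogeneous_X_pow i 2).pow k
  refine exists_eq_sum_eval_of_nonneg (isCompact_ZR_inter_sphere I)
    (LinearMap.pi (fun x => (aeval x : PolyS n →ₐ[ℝ] ℝ).toLinearMap) ∘ₗ Submodule.subtype _)
    (fun F => (F : PolyS n).continuous_eval.continuousOn) ⟨_, hg⟩ ?_ l
    fun F hF => hl F (nonneg_on_ZR_of_nonneg_on_sphere hk hhom F.2 hF)
  rintro x ⟨-, hx⟩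
  simp [hx]

/-- A linear functional on the degree-`2k` forms is nonnegative on all forms nonnegative on
`Z(I)` if and only if it is a finite nonnegative combination of point evaluations at points
of `Z(I)`; in particular it is then given by integration against a finite Borel measure
supported on `Z(I) ∩ Sⁿ`. -/
theorem statement16 {n : ℕ} (I : Ideal (PolyS n)) (hhom : IsHomIdeal I)
    (k : ℕ) (hk : 1 ≤ k)
    (l : homogeneousSubmodule (Fin (n + 1)) ℝ (2 * k) →ₗ[ℝ] ℝ) :
    ((∀ F : homogeneousSubmodule (Fin (n + 1)) ℝ (2 * k),
        (∀ x ∈ ZR I, 0 ≤ aeval x (F : PolyS n)) → 0 ≤ l F) ↔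
      ∃ (s : ℕ) (c : Fin s → ℝ) (x : Fin s → (Fin (n + 1) → ℝ)),
        (∀ i, 0 ≤ c i) ∧ (∀ i, x i ∈ ZR I) ∧
        ∀ F : homogeneousSubmodule (Fin (n + 1)) ℝ (2 * k),
          l F = ∑ i, c i * aeval (x i) (F : PolyS n)) ∧
    ((∀ F : homogeneousSubmodule (Fin (n + 1)) ℝ (2 * k),
        (∀ x ∈ ZR I, 0 ≤ aeval x (F : PolyS n)) → 0 ≤ l F) →
      ∃ μ : Measure (Fin (n + 1) → ℝ), IsFiniteMeasure μ ∧
        μ ({x | x ∈ ZR I ∧ ∑ i, x i ^ 2 = 1}ᶜ) = 0 ∧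
        ∀ F : homogeneousSubmodule (Fin (n + 1)) ℝ (2 * k),
          l F = ∫ x, aeval x (F : PolyS n) ∂μ) := by
  have hrep := exists_eq_sum_aeval_on_sphere I hhom k hk l
  refine ⟨⟨fun hl => ?_, ?_⟩, fun hl => ?_⟩
  · obtain ⟨s, c, x, hc, hx, h⟩ := hrep hl
    exact ⟨s, c, x, hc, fun i => (hx i).1, h⟩
  · rintro ⟨s, c, x, hc, hx, h⟩ F hF
    rw [h]
    exact Finset.sum_nonneg fun i _ => mul_nonneg (hc i) (hF _ (hx i))
  · obtain ⟨s, c, x, hc, hx, h⟩ := hrep hl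
    refine ⟨∑ i, ENNReal.ofReal (c i) • Measure.dirac (x i), ⟨?_⟩, ?_, fun F => ?_⟩
    · simp [Measure.finsetSum_apply]
    · have hmeas := (isCompact_ZR_inter_sphere I).measurableSet.compl
      rw [Measure.finsetSum_apply]
      refine Finset.sum_eq_zero fun i _ => ?_
      rw [Measure.smul_apply, Measure.dirac_apply' _ hmeas,
        Set.indicator_of_notMem (not_not_intro (hx i)), smul_zero]
    · rw [h, integral_finsetSum_measure fun i _ =>
        (integrable_dirac (by simp)).smul_measure ENNReal.ofReal_ne_top]
      refine Finset.sum_congr rfl fun i _ => ?_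
      rw [integral_smul_measure, integral_dirac, ENNReal.toReal_ofReal (hc i), smul_eq_mul]
end
end

section
/- Let G be a finite simple graph on vertex set V = S ∪ T, where S ∩ T is a clique of G and every edge of G has both endpoints in S or both endpoints in T (no edges between S ∖ T and T ∖ S). Let C_G^S = { A ∈ C_G : A_{ij} = 0 unless i ∈ S and j ∈ S } and C_G^T = { A ∈ C_G : A_{ij} = 0 unless i ∈ T and j ∈ T }. Then C_G equals the set of sums B + B' with B ∈ C_G^S and B' ∈ C_G^T (i.e., C_G is the conic hull of C_G^S ∪ C_G^T), and both C_G^S and C_G^T are faces of C_G. -/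
noncomputable section

/-- The cone `C_G` of positive semidefinite matrices supported on the (looped) edges of `G`. -/
def CGcone {V : Type*} [Fintype V] (G : SimpleGraph V) : Set (Matrix V V ℝ) :=
  { A | A.PosSemidef ∧ ∀ i j, i ≠ j → ¬ G.Adj i j → A i j = 0 }

/-- The subcone of `C_G` of matrices supported on a vertex subset `S`. -/
def CGconeOn {V : Type*} [Fintype V] (G : SimpleGraph V) (S : Set V) : Set (Matrix V V ℝ) :=
  { A | A ∈ CGcone G ∧ ∀ i j, ¬ (i ∈ S ∧ j ∈ S) → A i j = 0 }

open scoped MatrixOrder in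
/-- Every real positive semidefinite matrix is a Gram matrix. -/
theorem Matrix.PosSemidef.exists_eq_gram_s17 {V : Type*} [Fintype V] {A : Matrix V V ℝ}
    (hA : A.PosSemidef) : ∃ v : V → EuclideanSpace ℝ V, A = Matrix.gram ℝ v := by
  classical
  obtain ⟨R, rfl⟩ := CStarAlgebra.nonneg_iff_eq_star_mul_self.mp hA.nonneg
  refine ⟨fun i => WithLp.toLp 2 (fun k => R k i), ?_⟩
  ext i j
  simp [Matrix.mul_apply, PiLp.inner_apply, Matrix.star_eq_conjTranspose, mul_comm]

/-- A positive semidefinite matrix whose diagonal vanishes outside `S` is supported on `S`. -/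
theorem Matrix.PosSemidef.apply_eq_zero_of_diag_eq_zero {V : Type*} [Fintype V]
    {A : Matrix V V ℝ} (hA : A.PosSemidef) {S : Set V} (hS : ∀ i, i ∉ S → A i i = 0)
    (i j : V) (hij : ¬ (i ∈ S ∧ j ∈ S)) : A i j = 0 := by
  obtain ⟨v, rfl⟩ := hA.exists_eq_gram_s17
  have hv : ∀ i, i ∉ S → v i = 0 := fun i hi => inner_self_eq_zero.mp (hS i hi)
  rw [Matrix.gram_apply]
  by_cases hi : i ∈ S
  · rw [hv j fun hj => hij ⟨hi, hj⟩, inner_zero_right]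
  · rw [hv i hi, inner_zero_left]

/-- The matrices of `C_G` supported on `S` form a face of `C_G`. -/
theorem mem_CGconeOn_of_add_mem {V : Type*} [Fintype V] {G : SimpleGraph V} {S : Set V}
    {B B' : Matrix V V ℝ} (hB : B ∈ CGcone G) (hB' : B' ∈ CGcone G)
    (h : B + B' ∈ CGconeOn G S) : B ∈ CGconeOn G S ∧ B' ∈ CGconeOn G S := by
  have hdiag : ∀ i, i ∉ S → B i i = 0 ∧ B' i i = 0 := fun i hi =>
    (add_eq_zero_iff_of_nonneg hB.1.diag_nonneg hB'.1.diag_nonneg).mp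
      (h.2 i i fun hii => hi hii.1)
  exact ⟨⟨hB, hB.1.apply_eq_zero_of_diag_eq_zero fun i hi => (hdiag i hi).1⟩,
    ⟨hB', hB'.1.apply_eq_zero_of_diag_eq_zero fun i hi => (hdiag i hi).2⟩⟩

theorem CGcone_add_mem {V : Type*} [Fintype V] {G : SimpleGraph V} {B B' : Matrix V V ℝ}
    (hB : B ∈ CGcone G) (hB' : B' ∈ CGcone G) : B + B' ∈ CGcone G :=
  ⟨hB.1.add hB'.1, fun i j hij hadj => by
    rw [Matrix.add_apply, hB.2 i j hij hadj, hB'.2 i j hij hadj, add_zero]⟩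

/-- A Gram matrix splits along a subspace and its orthogonal complement. -/
theorem Matrix.gram_eq_gram_starProjection_add {V E : Type*} [NormedAddCommGroup E]
    [InnerProductSpace ℝ E] (K : Submodule ℝ E) [K.HasOrthogonalProjection] (v : V → E) :
    Matrix.gram ℝ v =
      Matrix.gram ℝ (fun i => K.starProjection (v i)) +
        Matrix.gram ℝ (fun i => Kᗮ.starProjection (v i)) := by
  ext i j
  have h₁ := K.inner_right_of_mem_orthogonal (K.starProjection_apply_mem (v i))
    (Kᗮ.starProjection_apply_mem (v j))
  have h₂ := K.inner_left_of_mem_orthogonal (K.starProjection_apply_mem (v j))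
    (Kᗮ.starProjection_apply_mem (v i))
  rw [Matrix.add_apply, Matrix.gram_apply, Matrix.gram_apply, Matrix.gram_apply]
  conv_lhs => rw [← K.starProjection_add_starProjection_orthogonal (v i),
    ← K.starProjection_add_starProjection_orthogonal (v j)]
  rw [inner_add_left, inner_add_right, inner_add_right, h₁, h₂, add_zero, zero_add]

/-- A positive semidefinite matrix vanishing on the rectangle `Tᶜ × Sᶜ` is a
sum of positive semidefinite matrices supported on `S` and on `T`. -/
theorem Matrix.PosSemidef.exists_add_of_apply_eq_zero {V : Type*} [Fintype V]
    {A : Matrix V V ℝ} (hA : A.PosSemidef) {S T : Set V}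
    (hzero : ∀ i j, i ∉ T → j ∉ S → A i j = 0) :
    ∃ B B' : Matrix V V ℝ, B.PosSemidef ∧ B'.PosSemidef ∧ A = B + B' ∧
      (∀ i j, ¬ (i ∈ S ∧ j ∈ S) → B i j = 0) ∧ (∀ i j, ¬ (i ∈ T ∧ j ∈ T) → B' i j = 0) := by
  obtain ⟨v, rfl⟩ := hA.exists_eq_gram_s17
  let K : Submodule ℝ (EuclideanSpace ℝ V) := Submodule.span ℝ (v '' Tᶜ)
  refine ⟨_, _, Matrix.posSemidef_gram ℝ _, Matrix.posSemidef_gram ℝ _,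
    Matrix.gram_eq_gram_starProjection_add K v,
    (Matrix.posSemidef_gram ℝ _).apply_eq_zero_of_diag_eq_zero fun j hj => ?_,
    (Matrix.posSemidef_gram ℝ _).apply_eq_zero_of_diag_eq_zero fun i hi => ?_⟩
  · have hmem : v j ∈ Kᗮ := by
      rw [Submodule.mem_orthogonal]
      intro u hu
      induction hu using Submodule.span_induction with
      | mem x hx =>
        obtain ⟨i, hi, rfl⟩ := hx
        exact hzero i j hi hj
      | zero => exact inner_zero_left _
      | add x y _ _ hx hy => rw [inner_add_left, hx, hy, add_zero]
      | smul a x _ hx => rw [inner_smul_left, hx, mul_zero]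
    simp [K.starProjection_apply_eq_zero_iff.mpr hmem]
  · have hmem : v i ∈ K := Submodule.subset_span ⟨i, hi, rfl⟩
    simp [Submodule.starProjection_eq_self_iff.mpr hmem]

/-- If `G` is the clique sum of its induced subgraphs on `S` and `T` (so `S ∩ T` is a
clique and all edges lie within `S` or within `T`), then `C_G` is the conic hull of
`C_G^S ∪ C_G^T`, and both `C_G^S` and `C_G^T` are faces of `C_G`. -/
theorem statement17 {V : Type*} [Fintype V] [DecidableEq V] (G : SimpleGraph V)
    (S T : Set V) (hST : S ∪ T = Set.univ)
    (hclique : G.IsClique (S ∩ T))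
    (hedge : ∀ i j, G.Adj i j → (i ∈ S ∧ j ∈ S) ∨ (i ∈ T ∧ j ∈ T)) :
    (∀ A : Matrix V V ℝ, A ∈ CGcone G ↔
      ∃ B ∈ CGconeOn G S, ∃ B' ∈ CGconeOn G T, A = B + B') ∧
    (∀ B ∈ CGcone G, ∀ B' ∈ CGcone G, B + B' ∈ CGconeOn G S →
      B ∈ CGconeOn G S ∧ B' ∈ CGconeOn G S) ∧
    (∀ B ∈ CGcone G, ∀ B' ∈ CGcone G, B + B' ∈ CGconeOn G T →
      B ∈ CGconeOn G T ∧ B' ∈ CGconeOn G T) := by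
  refine ⟨fun A => ⟨fun hA => ?_, ?_⟩, fun B hB B' hB' => mem_CGconeOn_of_add_mem hB hB',
    fun B hB B' hB' => mem_CGconeOn_of_add_mem hB hB'⟩
  · have hcover : ∀ i, i ∈ S ∨ i ∈ T := fun i => by
      simpa [← hST] using Set.mem_univ i
    obtain ⟨B, B', hB, hB', rfl, hBS, hBT⟩ := hA.1.exists_add_of_apply_eq_zero
      fun i j hi hj => hA.2 i j
        (by rintro rfl; exact (hcover i).elim hj hi)
        (fun hadj => (hedge i j hadj).elim (fun h => hj h.2) (fun h => hi h.1))
    have hsum : ∀ i j, i ≠ j → ¬ G.Adj i j → B i j + B' i j = 0 := hA.2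
    refine ⟨B, ⟨⟨hB, fun i j hij hadj => ?_⟩, hBS⟩, B', ⟨⟨hB', fun i j hij hadj => ?_⟩, hBT⟩, rfl⟩
    all_goals
      have hzero := hsum i j hij hadj
      by_cases hS : i ∈ S ∧ j ∈ S
      · by_cases hT : i ∈ T ∧ j ∈ T
        · exact absurd (hclique ⟨hS.1, hT.1⟩ ⟨hS.2, hT.2⟩ hij) hadj
        · linarith [hBT i j hT]
      · linarith [hBS i j hS]
  · rintro ⟨B, hB, B', hB', rfl⟩
    exact CGcone_add_mem hB.1 hB'.1
end
end
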